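/- Let d ≥ 3 and fix κ > 0. There exist constants c(κ) > 0 and c' > 0 such that for every integer L_0 ≥ c(κ), with u_0 = κ(log L_0)²·L_0^{−(d−2)} and for every vacant-set law Q at level u_0, the probability that {x ∈ ℤ^d : Y_x = 0} contains a *-path lying in ([0, 2L_0]×[0, 6L_0]×{0}^{d−2}) ∩ ℤ^d that starts in {0}×[0, 6L_0]×{0}^{d−2} and ends in {2L_0 − 1}×[0, 6L_0]×{0}^{d−2} is at most exp{ −c'·(log L_0)^{2/3}·exp((log L_0)^{1/3}) }. -/

import Mathlib

open MeasureTheory Filter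

namespace RI

/-- Points of `ℤ^d`. -/
abbrev Zd (d : ℕ) := Fin d → ℤ

/-- `x` and `y` are nearest neighbours: `|x - y| = 1`. -/
def adj {d : ℕ} (x y : Zd d) : Prop := (∑ i, |x i - y i|) = 1

/-- `x` and `y` are `*`-neighbours: `|x - y|_∞ = 1`. -/
def starAdj {d : ℕ} (x y : Zd d) : Prop := x ≠ y ∧ ∀ i, |x i - y i| ≤ 1

/-- `x` belongs to the plane `ℤ e₁ + ℤ e₂ ⊆ ℤ^d`. -/
def inPlane {d : ℕ} (x : Zd d) : Prop := ∀ i : Fin d, 2 ≤ (i : ℕ) → x i = 0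

/-- The `k`-th coordinate of `x`, with value `0` for out-of-range indices. -/
def coord {d : ℕ} (x : Zd d) (k : ℕ) : ℤ := if h : k < d then x ⟨k, h⟩ else 0

/-- `P` is the family of laws of the simple random walks on `ℤ^d` started at the points of
`ℤ^d`: each `P x` is a probability measure on the path space `ℕ → ℤ^d`, and the cylinder
probabilities are those of the walk with i.i.d. increments uniform on `{± e_i}`. -/
def IsSRW (d : ℕ) (P : Zd d → Measure (ℕ → Zd d)) : Prop :=
  (∀ x, IsProbabilityMeasure (P x)) ∧
  (∀ (x : Zd d) (n : ℕ) (w : ℕ → Zd d),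
      (w 0 = x ∧ ∀ k < n, adj (w k) (w (k + 1))) →
        P x {ω | ∀ k ≤ n, ω k = w k} = ((2 * d : ENNReal))⁻¹ ^ n) ∧
  (∀ (x : Zd d) (n : ℕ) (w : ℕ → Zd d),
      ¬(w 0 = x ∧ ∀ k < n, adj (w k) (w (k + 1))) →
        P x {ω | ∀ k ≤ n, ω k = w k} = 0)

/-- The equilibrium measure of a set `V ⊆ ℤ^d`:
`e_V(x) = P_x[H̃_V = ∞]` for `x ∈ V`, and `0` otherwise. -/
noncomputable def eqm {d : ℕ} (P : Zd d → Measure (ℕ → Zd d)) (V : Set (Zd d)) : Zd d → ℝ :=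
  V.indicator fun x => (P x {ω | ∀ n, 1 ≤ n → ω n ∉ V}).toReal

/-- The capacity of a finite set `K ⊆ ℤ^d`. -/
noncomputable def capa {d : ℕ} (P : Zd d → Measure (ℕ → Zd d)) (K : Finset (Zd d)) : ℝ :=
  ∑ x ∈ K, eqm P (↑K) x

/-- `Q` is a vacant-set law at level `u`: a probability measure on `{0,1}^{ℤ^d}`
(with `true = 1` standing for "vacant") such that
`Q[Y_x = 1 ∀ x ∈ K] = exp(-u cap K)` for every finite `K`. -/
def IsVacantLaw {d : ℕ} (P : Zd d → Measure (ℕ → Zd d)) (u : ℝ)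
    (Q : Measure (Zd d → Bool)) : Prop :=
  IsProbabilityMeasure Q ∧
  ∀ K : Finset (Zd d),
    Q {Y | ∀ x ∈ K, Y x = true} = ENNReal.ofReal (Real.exp (-(u * capa P K)))

/-- There is a `*`-path starting in `S`, ending in `T`, all of whose points lie in `A`. -/
def HasStarPath {d : ℕ} (S T A : Set (Zd d)) : Prop :=
  ∃ (N : ℕ) (w : ℕ → Zd d), w 0 ∈ S ∧ w N ∈ T ∧ (∀ k ≤ N, w k ∈ A) ∧
    ∀ k < N, starAdj (w k) (w (k + 1))

/-- Interior boundary `∂_int U`. -/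
def intBdry {d : ℕ} (U : Set (Zd d)) : Set (Zd d) := {x | x ∈ U ∧ ∃ y, y ∉ U ∧ adj x y}

/-- (Exterior) boundary `∂U`. -/
def bdry {d : ℕ} (U : Set (Zd d)) : Set (Zd d) := {x | x ∉ U ∧ ∃ y ∈ U, adj x y}

/-- `ℓ = 100 ⌊L^{1/100}⌋ + 1`. -/
noncomputable def ellOf (L : ℕ) : ℕ := 100 * ⌊(L : ℝ) ^ ((1 : ℝ) / 100)⌋₊ + 1

/-- The scales `L_{n+1} = ℓ_n L_n`. -/
noncomputable def Lseq (L0 : ℕ) : ℕ → ℕ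
  | 0 => L0
  | n + 1 => ellOf (Lseq L0 n) * Lseq L0 n

/-- The levels `u_{n+1} = (1 + 1/log L_n)⁻¹ u_n`. -/
noncomputable def useq (L0 : ℕ) (u0 : ℝ) : ℕ → ℝ
  | 0 => u0
  | n + 1 => (1 + 1 / Real.log (Lseq L0 n))⁻¹ * useq L0 u0 n

/-- The event (on the configuration space `{0,1}^{ℤ^d}`) that there is a `*`-path from
`[-L,L]² ∩ ℤ²` to `∂_int ([-3L,3L]^d ∩ ℤ^d)` all of whose points lie in `{x ∈ ℤ² : Y_x = 0}`. -/
def qEvent (d : ℕ) (L : ℕ) : Set (Zd d → Bool) :=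
  {Y | HasStarPath
    {x : Zd d | inPlane x ∧ ∀ i, |x i| ≤ (L : ℤ)}
    (intBdry {x : Zd d | ∀ i, |x i| ≤ (3 * L : ℤ)})
    {x : Zd d | inPlane x ∧ Y x = false}}


end RI

open RI MeasureTheory Filter

namespace RI

/-- The signed unit vector labelled by `e`. -/
def stepVec {d : ℕ} (e : Fin d × Bool) : Zd d := Pi.single e.1 (if e.2 then 1 else -1)

/-- The mean of `f` over the nearest neighbours of `x`. -/
noncomputable def avg {d : ℕ} (f : Zd d → ℝ) (x : Zd d) : ℝ :=
  (2 * d : ℝ)⁻¹ * ∑ e : Fin d × Bool, f (x + stepVec e)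

/-- Prepend the point `x` to the path `ω`. -/
def pcons {d : ℕ} (x : Zd d) (ω : ℕ → Zd d) : ℕ → Zd d
  | 0 => x
  | n + 1 => ω n

lemma stepVec_injective {d : ℕ} : Function.Injective (stepVec (d := d)) := by
  rintro ⟨i, a⟩ ⟨j, b⟩ h
  have hi := congrFun h i
  have hij : i = j := by
    by_contra hne
    simp only [stepVec, Pi.single_eq_same, Pi.single_eq_of_ne hne] at hi
    cases a <;> simp at hi
  subst hij
  simp only [stepVec, Pi.single_eq_same] at hi
  cases a <;> cases b <;> simp at hi ⊢

lemma adj_iff_exists_stepVec {d : ℕ} (x y : Zd d) : adj x y ↔ ∃ e, y = x + stepVec e := by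
  constructor
  · intro h
    unfold adj at h
    have hex : ∃ i, x i ≠ y i := by
      by_contra! hcon
      simp [hcon] at h
    obtain ⟨i, hi⟩ := hex
    rw [← Finset.add_sum_erase _ _ (Finset.mem_univ i)] at h
    have h0 : 0 ≤ ∑ j ∈ Finset.univ.erase i, |x j - y j| :=
      Finset.sum_nonneg fun _ _ => abs_nonneg _
    have h1 : 1 ≤ |x i - y i| := Int.one_le_abs (sub_ne_zero.2 hi)
    have h2 : ∑ j ∈ Finset.univ.erase i, |x j - y j| = 0 := by linarith
    have h3 : |x i - y i| = 1 := by linarith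
    rw [Finset.sum_eq_zero_iff_of_nonneg fun _ _ => abs_nonneg _] at h2
    have h4 : ∀ j, j ≠ i → x j = y j := fun j hj => by
      have := h2 j (Finset.mem_erase.2 ⟨hj, Finset.mem_univ _⟩)
      exact sub_eq_zero.1 (abs_eq_zero.1 this)
    rcases (abs_eq (by norm_num)).1 h3 with h5 | h5
    · refine ⟨(i, false), ?_⟩
      ext j
      by_cases hj : j = i
      · subst hj; simp [stepVec]; linarith
      · simp [stepVec, Pi.single_eq_of_ne hj, h4 j hj]
    · refine ⟨(i, true), ?_⟩
      ext j
      by_cases hj : j = i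
      · subst hj; simp [stepVec]; linarith
      · simp [stepVec, Pi.single_eq_of_ne hj, h4 j hj]
  · rintro ⟨⟨i, b⟩, rfl⟩
    unfold adj
    rw [Finset.sum_eq_single i]
    · cases b <;> simp [stepVec]
    · intro j _ hj
      simp [stepVec, Pi.single_eq_of_ne hj]
    · simp

lemma measurable_pcons {d : ℕ} (x : Zd d) : Measurable (pcons x) := by
  refine measurable_pi_lambda _ fun n => ?_
  cases n with
  | zero => exact measurable_const
  | succ n => exact measurable_pi_apply n

/-- The cylinder of paths agreeing with `w` up to time `n`. -/
def cyl {d : ℕ} (n : ℕ) (w : ℕ → Zd d) : Set (ℕ → Zd d) := {ω | ∀ k ≤ n, ω k = w k}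

lemma measurableSet_coord {d : ℕ} (n : ℕ) (G : Set (Zd d)) :
    MeasurableSet {ω : ℕ → Zd d | ω n ∈ G} :=
  measurable_pi_apply n (MeasurableSet.of_discrete (s := G))

lemma measurableSet_cyl {d : ℕ} (n : ℕ) (w : ℕ → Zd d) : MeasurableSet (cyl n w) := by
  have : cyl n w = ⋂ k ∈ Set.Iic n, {ω : ℕ → Zd d | ω k ∈ ({w k} : Set (Zd d))} := by
    ext ω; simp [cyl]
  rw [this]
  exact MeasurableSet.biInter (Set.to_countable _) fun k _ => measurableSet_coord k _

lemma isPiSystem_cyl {d : ℕ} :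
    IsPiSystem (Set.range fun q : ℕ × (ℕ → Zd d) => cyl q.1 q.2) := by
  rintro _ ⟨⟨n, w⟩, rfl⟩ _ ⟨⟨m, v⟩, rfl⟩ ⟨ω, hω1, hω2⟩
  refine ⟨⟨max n m, ω⟩, ?_⟩
  ext η
  simp only [cyl, Set.mem_ofPred_eq, Set.mem_inter_iff] at *
  constructor
  · intro h
    exact ⟨fun k hk => (h k (le_max_of_le_left hk)).trans (hω1 k hk),
      fun k hk => (h k (le_max_of_le_right hk)).trans (hω2 k hk)⟩
  · rintro ⟨h1, h2⟩ k hk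
    rcases le_max_iff.1 hk with h | h
    · exact (h1 k h).trans (hω1 k h).symm
    · exact (h2 k h).trans (hω2 k h).symm

lemma generateFrom_cyl {d : ℕ} :
    (MeasurableSpace.pi : MeasurableSpace (ℕ → Zd d)) =
      MeasurableSpace.generateFrom (Set.range fun q : ℕ × (ℕ → Zd d) => cyl q.1 q.2) := by
  apply le_antisymm
  · refine iSup_le fun k => ?_
    rw [← measurable_iff_comap_le]
    let _ : MeasurableSpace (ℕ → Zd d) :=
      MeasurableSpace.generateFrom (Set.range fun q : ℕ × (ℕ → Zd d) => cyl q.1 q.2)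
    refine measurable_to_countable' fun v => ?_
    have : (fun ω : ℕ → Zd d => ω k) ⁻¹' {v} =
        ⋃ u : Fin (k + 1) → Zd d, ⋃ _ : u (Fin.last k) = v,
          cyl k (fun j => if h : j < k + 1 then u ⟨j, h⟩ else 0) := by
      ext ω
      simp only [Set.mem_preimage, Set.mem_singleton_iff, Set.mem_iUnion, cyl, Set.mem_ofPred_eq,
        exists_prop]
      constructor
      · intro h
        refine ⟨fun j => ω j, by simpa using h, fun j hj => ?_⟩
        rw [dif_pos (Nat.lt_succ_of_le hj)]
      · rintro ⟨u, hu, h⟩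
        have := h k le_rfl
        rw [dif_pos (Nat.lt_succ_self k)] at this
        rw [this]; exact hu
    rw [this]
    refine MeasurableSet.iUnion fun u => MeasurableSet.iUnion fun _ => ?_
    exact MeasurableSpace.measurableSet_generateFrom ⟨⟨_, _⟩, rfl⟩
  · refine MeasurableSpace.generateFrom_le ?_
    rintro _ ⟨⟨n, w⟩, rfl⟩
    exact measurableSet_cyl n w

lemma pcons_preimage_cyl_zero {d : ℕ} (x : Zd d) (w : ℕ → Zd d) :
    pcons x ⁻¹' cyl 0 w = {_ω | x = w 0} := by
  ext ω; simp [cyl, pcons]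

lemma pcons_preimage_cyl_succ {d : ℕ} (x : Zd d) (n : ℕ) (w : ℕ → Zd d) (h : x = w 0) :
    pcons x ⁻¹' cyl (n + 1) w = cyl n (fun k => w (k + 1)) := by
  ext ω
  simp only [cyl, Set.mem_preimage, Set.mem_ofPred_eq]
  constructor
  · intro H k hk
    exact H (k + 1) (by omega)
  · intro H k hk
    cases k with
    | zero => exact h
    | succ k => exact H k (by omega)

/-- The Markov property at time one. -/
lemma IsSRW.first_step_measure {d : ℕ} (hd : 0 < d) {P : Zd d → Measure (ℕ → Zd d)}
    (hP : IsSRW d P) (x : Zd d) :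
    P x = ∑ e : Fin d × Bool, ((2 * d : ENNReal))⁻¹ • (P (x + stepVec e)).map (pcons x) := by
  have := hP.1
  obtain ⟨h1, h2, h3⟩ := hP
  have hd0 : (2 * d : ENNReal) ≠ 0 := by
    simp [hd.ne']
  have hdt : (2 * d : ENNReal) ≠ ⊤ := ENNReal.mul_ne_top (by simp) (by simp)
  have hcard : ∑ _e : Fin d × Bool, ((2 * d : ENNReal))⁻¹ = 1 := by
    rw [Finset.sum_const, Finset.card_univ, Fintype.card_prod, Fintype.card_fin,
      Fintype.card_bool, nsmul_eq_mul]
    push_cast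
    rw [mul_comm (d : ENNReal) 2]
    exact ENNReal.mul_inv_cancel hd0 hdt
  refine ext_of_generate_finite _ generateFrom_cyl isPiSystem_cyl ?_ ?_
  · rintro _ ⟨⟨n, w⟩, rfl⟩
    simp only [Measure.coe_finsetSum, Finset.sum_apply, Measure.smul_apply, smul_eq_mul]
    simp_rw [Measure.map_apply (measurable_pcons x) (measurableSet_cyl n w)]
    cases n with
    | zero =>
      rw [pcons_preimage_cyl_zero]
      by_cases hx : w 0 = x
      · have := h2 x 0 w ⟨hx, by simp⟩
        simp only [cyl]
        rw [this]
        simp [hx, hcard]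
      · have := h3 x 0 w (fun h => hx h.1)
        simp only [cyl]
        rw [this]
        simp [Ne.symm hx]
    | succ n =>
      by_cases hx : w 0 = x
      · rw [pcons_preimage_cyl_succ x n w hx.symm]
        by_cases hadj : ∀ k < n + 1, adj (w k) (w (k + 1))
        · obtain ⟨e, he⟩ := (adj_iff_exists_stepVec _ _).1 (hadj 0 (by omega))
          rw [hx] at he
          have hL := h2 x (n + 1) w ⟨hx, hadj⟩
          simp only [cyl]
          rw [hL, Finset.sum_eq_single e]
          · rw [h2 (x + stepVec e) n (fun k => w (k + 1))
              ⟨he, fun k hk => hadj (k + 1) (by omega)⟩, pow_succ']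
          · intro e' _ hne
            rw [h3 (x + stepVec e') n (fun k => w (k + 1)), mul_zero]
            rintro ⟨h, -⟩
            apply hne
            apply stepVec_injective
            rw [he] at h
            exact (add_left_cancel h).symm
          · simp
        · have hL := h3 x (n + 1) w (fun h => hadj h.2)
          simp only [cyl]
          rw [hL, Finset.sum_eq_zero]
          intro e _
          rw [h3 (x + stepVec e) n (fun k => w (k + 1)), mul_zero]
          rintro ⟨h, h'⟩
          apply hadj
          intro k hk
          cases k with
          | zero =>
            rw [hx, adj_iff_exists_stepVec]
            exact ⟨e, h⟩
          | succ k => exact h' k (by omega)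
      · have hL := h3 x (n + 1) w (fun h => hx h.1)
        have hE : pcons x ⁻¹' cyl (n + 1) w = ∅ := by
          ext ω
          simp only [cyl, Set.mem_preimage, Set.mem_ofPred_eq, Set.mem_empty_iff_false, iff_false]
          intro h
          exact hx (h 0 (by omega)).symm
        simp only [cyl] at hE ⊢
        rw [hL, hE]
        simp
  · simp only [Measure.coe_finsetSum, Finset.sum_apply, Measure.smul_apply, smul_eq_mul]
    simp_rw [Measure.map_apply (measurable_pcons x) MeasurableSet.univ]
    simp [hcard]

lemma IsSRW.first_step {d : ℕ} (hd : 0 < d) {P : Zd d → Measure (ℕ → Zd d)}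
    (hP : IsSRW d P) (x : Zd d) {A : Set (ℕ → Zd d)} (hA : MeasurableSet A) :
    (P x).real A = (2 * d : ℝ)⁻¹ * ∑ e : Fin d × Bool,
      (P (x + stepVec e)).real (pcons x ⁻¹' A) := by
  have := hP.1
  have h : P x A = _ := congrArg (fun μ => μ A) (hP.first_step_measure hd x)
  simp only [Measure.coe_finsetSum, Finset.sum_apply, Measure.smul_apply, smul_eq_mul] at h
  simp_rw [Measure.map_apply (measurable_pcons x) hA] at h
  rw [Measure.real, h, ← Finset.mul_sum, ENNReal.toReal_mul,
    ENNReal.toReal_sum fun e _ => measure_ne_top _ _]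
  simp [Measure.real]

lemma avg_const {d : ℕ} (hd : 0 < d) (c : ℝ) (x : Zd d) : avg (fun _ => c) x = c := by
  have : (d : ℝ) ≠ 0 := by positivity
  simp [avg]
  field_simp

lemma avg_mono {d : ℕ} {f g : Zd d → ℝ} (h : ∀ y, f y ≤ g y) (x : Zd d) :
    avg f x ≤ avg g x := by
  unfold avg
  gcongr
  exact h _

lemma avg_nonneg {d : ℕ} {f : Zd d → ℝ} (h : ∀ y, 0 ≤ f y) (x : Zd d) : 0 ≤ avg f x := by
  unfold avg
  exact mul_nonneg (by positivity) (Finset.sum_nonneg fun _ _ => h _)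

lemma avg_const_mul {d : ℕ} (c : ℝ) (f : Zd d → ℝ) (x : Zd d) :
    avg (fun y => c * f y) x = c * avg f x := by
  simp only [avg, ← Finset.mul_sum]; ring

/-- Only the behaviour of the event on paths started at `x` matters. -/
lemma IsSRW.real_congr {d : ℕ} (hd : 0 < d) {P : Zd d → Measure (ℕ → Zd d)}
    (hP : IsSRW d P) (x : Zd d) {A B : Set (ℕ → Zd d)} (hA : MeasurableSet A)
    (hB : MeasurableSet B) (h : ∀ ω, pcons x ω ∈ A ↔ pcons x ω ∈ B) :
    (P x).real A = (P x).real B := by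
  rw [hP.first_step hd x hA, hP.first_step hd x hB]
  have : pcons x ⁻¹' A = pcons x ⁻¹' B := by
    ext ω; exact h ω
  rw [this]

lemma IsSRW.first_step_avg {d : ℕ} (hd : 0 < d) {P : Zd d → Measure (ℕ → Zd d)}
    (hP : IsSRW d P) (x : Zd d) {A B : Set (ℕ → Zd d)} (hA : MeasurableSet A)
    (h : ∀ ω, pcons x ω ∈ A ↔ ω ∈ B) :
    (P x).real A = avg (fun y => (P y).real B) x := by
  rw [hP.first_step hd x hA, avg]
  have : pcons x ⁻¹' A = B := by
    ext ω; exact h ω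
  rw [this]

/-- The paths that hit `G` without leaving `D` before. -/
def hitIn {d : ℕ} (G D : Set (Zd d)) : Set (ℕ → Zd d) := {ω | ∃ n, ω n ∈ G ∧ ∀ k ≤ n, ω k ∈ D}

/-- The probability that the walk hits `G` without leaving `D` before. -/
noncomputable def hitProb {d : ℕ} (P : Zd d → Measure (ℕ → Zd d)) (G D : Set (Zd d))
    (x : Zd d) : ℝ := (P x).real (hitIn G D)

lemma measurableSet_hitIn {d : ℕ} (G D : Set (Zd d)) : MeasurableSet (hitIn G D) := by
  have : hitIn G D = ⋃ n, ({ω | ω n ∈ G} ∩ ⋂ k ∈ Set.Iic n, {ω : ℕ → Zd d | ω k ∈ D}) := by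
    ext ω; simp [hitIn]
  rw [this]
  exact MeasurableSet.iUnion fun n => (measurableSet_coord n G).inter
    (MeasurableSet.biInter (Set.to_countable _) fun k _ => measurableSet_coord k D)

lemma hitIn_univ {d : ℕ} (G : Set (Zd d)) : hitIn G Set.univ = {ω | ∃ n, ω n ∈ G} := by
  simp [hitIn]

lemma pcons_mem_hitIn {d : ℕ} (G D : Set (Zd d)) (x : Zd d) (ω : ℕ → Zd d) :
    pcons x ω ∈ hitIn G D ↔ x ∈ D ∧ (x ∈ G ∨ ω ∈ hitIn G D) := by
  constructor
  · rintro ⟨n, hn, hk⟩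
    refine ⟨hk 0 (Nat.zero_le _), ?_⟩
    cases n with
    | zero => exact Or.inl hn
    | succ n => exact Or.inr ⟨n, hn, fun k hkn => hk (k + 1) (by omega)⟩
  · rintro ⟨hD, hG | ⟨n, hn, hk⟩⟩
    · refine ⟨0, hG, fun k hk => ?_⟩
      obtain rfl : k = 0 := by omega
      exact hD
    · refine ⟨n + 1, hn, fun k hkn => ?_⟩
      cases k with
      | zero => exact hD
      | succ k => exact hk k (by omega)

lemma hitProb_nonneg {d : ℕ} (P : Zd d → Measure (ℕ → Zd d)) (G D : Set (Zd d)) (x : Zd d) :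
    0 ≤ hitProb P G D x := measureReal_nonneg

lemma hitProb_le_one {d : ℕ} {P : Zd d → Measure (ℕ → Zd d)} (hP : IsSRW d P)
    (G D : Set (Zd d)) (x : Zd d) : hitProb P G D x ≤ 1 := by
  have := hP.1 x
  exact measureReal_le_one

lemma hitProb_eq_one {d : ℕ} (hd : 0 < d) {P : Zd d → Measure (ℕ → Zd d)} (hP : IsSRW d P)
    {G D : Set (Zd d)} {x : Zd d} (hG : x ∈ G) (hD : x ∈ D) : hitProb P G D x = 1 := by
  have := hP.1 x
  rw [hitProb, hP.real_congr hd x (measurableSet_hitIn G D) MeasurableSet.univ]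
  · simp
  · intro ω
    simp [pcons_mem_hitIn, hG, hD]

lemma hitProb_eq_zero {d : ℕ} (hd : 0 < d) {P : Zd d → Measure (ℕ → Zd d)} (hP : IsSRW d P)
    {G D : Set (Zd d)} {x : Zd d} (hD : x ∉ D) : hitProb P G D x = 0 := by
  rw [hitProb, hP.real_congr hd x (measurableSet_hitIn G D) MeasurableSet.empty]
  · simp
  · intro ω
    simp [pcons_mem_hitIn, hD]

lemma hitProb_eq_avg {d : ℕ} (hd : 0 < d) {P : Zd d → Measure (ℕ → Zd d)} (hP : IsSRW d P)
    {G D : Set (Zd d)} {x : Zd d} (hG : x ∉ G) (hD : x ∈ D) :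
    hitProb P G D x = avg (hitProb P G D) x :=
  hP.first_step_avg hd x (measurableSet_hitIn G D) fun ω => by
    simp [pcons_mem_hitIn, hD, hG]

lemma hitProb_mono {d : ℕ} {P : Zd d → Measure (ℕ → Zd d)} (hP : IsSRW d P)
    {G D E : Set (Zd d)} (h : D ⊆ E) (x : Zd d) : hitProb P G D x ≤ hitProb P G E x := by
  have := hP.1 x
  refine measureReal_mono ?_
  rintro ω ⟨n, hn, hk⟩
  exact ⟨n, hn, fun k hkn => h (hk k hkn)⟩

lemma eqm_eq {d : ℕ} (hd : 0 < d) {P : Zd d → Measure (ℕ → Zd d)} (hP : IsSRW d P)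
    {K : Set (Zd d)} {x : Zd d} (hx : x ∈ K) :
    eqm P K x = 1 - avg (hitProb P K Set.univ) x := by
  have hp := hP.1
  have hms : MeasurableSet {ω : ℕ → Zd d | ∀ n, 1 ≤ n → ω n ∉ K} := by
    have : {ω : ℕ → Zd d | ∀ n, 1 ≤ n → ω n ∉ K} = ⋂ n ∈ Set.Ici 1, {ω | ω n ∈ Kᶜ} := by
      ext ω; simp
    rw [this]
    exact MeasurableSet.biInter (Set.to_countable _) fun k _ => measurableSet_coord k _
  rw [eqm, Set.indicator_of_mem hx]
  change (P x).real _ = _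
  rw [hP.first_step_avg hd x (B := (hitIn K Set.univ)ᶜ) hms]
  · have : (fun y => (P y).real (hitIn K Set.univ)ᶜ) = fun y => 1 - hitProb P K Set.univ y := by
      ext y
      rw [probReal_compl_eq_one_sub (measurableSet_hitIn _ _), hitProb]
    rw [this]
    have h1 := avg_const hd 1 x
    simp only [avg, Finset.sum_sub_distrib, mul_sub] at h1 ⊢
    rw [h1]
  · intro ω
    rw [hitIn_univ]
    simp only [Set.mem_ofPred_eq, Set.mem_compl_iff, not_exists]
    constructor
    · intro h n
      exact h (n + 1) (by omega)
    · intro h n hn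
      cases n with
      | zero => omega
      | succ n => exact h n

lemma eqm_nonneg {d : ℕ} (P : Zd d → Measure (ℕ → Zd d)) (K : Set (Zd d)) (x : Zd d) :
    0 ≤ eqm P K x :=
  Set.indicator_nonneg (fun _ _ => ENNReal.toReal_nonneg) x

lemma eqm_eq_zero_of_interior {d : ℕ} (hd : 0 < d) {P : Zd d → Measure (ℕ → Zd d)}
    (hP : IsSRW d P) {K : Set (Zd d)} {x : Zd d} (hx : x ∈ K)
    (h : ∀ e, x + stepVec e ∈ K) : eqm P K x = 0 := by
  have h1 := avg_const hd 1 x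
  rw [eqm_eq hd hP hx]
  have : avg (hitProb P K Set.univ) x = avg (fun _ => 1) x := by
    unfold avg
    congr 1
    exact Finset.sum_congr rfl fun e _ => hitProb_eq_one hd hP (h e) (Set.mem_univ _)
  rw [this, h1, sub_self]

/-- The averaging operator is symmetric. -/
lemma tsum_avg_mul {d : ℕ} {f : Zd d → ℝ} (hf : f.support.Finite) (g : Zd d → ℝ) :
    ∑' x, avg f x * g x = ∑' x, f x * avg g x := by
  have hs1 : ∀ e : Fin d × Bool, Summable fun x => f (x + stepVec e) * g x := fun e => by
    apply summable_of_hasFiniteSupport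
    refine (hf.preimage ((add_left_injective (stepVec e)).injOn)).subset ?_
    intro x hx
    exact left_ne_zero_of_mul hx
  have hs2 : ∀ e : Fin d × Bool, Summable fun x => f x * g (x + stepVec e) := fun e => by
    apply summable_of_hasFiniteSupport
    exact hf.subset fun x hx => left_ne_zero_of_mul hx
  have hL : ∑' x, avg f x * g x =
      (2 * d : ℝ)⁻¹ * ∑ e : Fin d × Bool, ∑' x, f (x + stepVec e) * g x := by
    rw [← Summable.tsum_finsetSum fun e _ => hs1 e, ← tsum_mul_left]
    congr 1; ext x
    rw [avg, mul_assoc, Finset.sum_mul]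
  have hR : ∑' x, f x * avg g x =
      (2 * d : ℝ)⁻¹ * ∑ e : Fin d × Bool, ∑' x, f x * g (x + stepVec e) := by
    rw [← Summable.tsum_finsetSum fun e _ => hs2 e, ← tsum_mul_left]
    congr 1; ext x
    rw [avg, ← Finset.mul_sum]; ring
  rw [hL, hR]
  congr 1
  let ne : Fin d × Bool ≃ Fin d × Bool := Equiv.prodCongr (Equiv.refl _) Equiv.boolNot
  rw [← ne.sum_comp]
  refine Finset.sum_congr rfl fun e _ => ?_
  have hne : stepVec (ne e) = - stepVec e := by
    obtain ⟨i, b⟩ := e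
    ext j
    by_cases hj : j = i
    · subst hj
      cases b <;> simp [stepVec, ne, Equiv.boolNot]
    · simp [stepVec, ne, Pi.single_eq_of_ne hj]
  rw [hne, ← (Equiv.addRight (stepVec e)).tsum_eq]
  simp

lemma tsum_sub_avg_mul {d : ℕ} {f : Zd d → ℝ} (hf : f.support.Finite) (g : Zd d → ℝ) :
    ∑' x, (f x - avg f x) * g x = ∑' x, f x * (g x - avg g x) := by
  have h1 : Summable fun x => f x * g x :=
    summable_of_hasFiniteSupport (hf.subset fun x hx => left_ne_zero_of_mul hx)
  have h2 : Summable fun x => f x * avg g x :=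
    summable_of_hasFiniteSupport (hf.subset fun x hx => left_ne_zero_of_mul hx)
  have hfin : (⋃ e : Fin d × Bool, (· + stepVec e) ⁻¹' f.support).Finite :=
    Set.finite_iUnion fun e => hf.preimage ((add_left_injective (stepVec e)).injOn)
  have h3 : Summable fun x => avg f x * g x := by
    refine summable_of_hasFiniteSupport (hfin.subset fun x hx => ?_)
    have hx' : avg f x ≠ 0 := left_ne_zero_of_mul hx
    by_contra hcon
    apply hx'
    simp only [Set.mem_iUnion, Set.mem_preimage, Function.mem_support, not_exists, not_not] at hcon
    simp [avg, hcon]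
  simp_rw [sub_mul, mul_sub]
  rw [h1.tsum_sub h3, h1.tsum_sub h2, tsum_avg_mul hf]

/-- The sweeping identity for the killed walk. -/
lemma sum_escape_mul_hitProb_finite {d : ℕ} (hd : 0 < d) {P : Zd d → Measure (ℕ → Zd d)}
    (hP : IsSRW d P) {S K : Finset (Zd d)} {D : Set (Zd d)} (hD : D.Finite)
    (hSK : S ⊆ K) (hKD : ↑K ⊆ D) :
    ∑ x ∈ K, (1 - avg (hitProb P K D) x) * hitProb P S D x =
      ∑ x ∈ S, (1 - avg (hitProb P S D) x) := by
  have key : ∀ A B : Finset (Zd d), ↑A ⊆ D →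
      ∑' x, (hitProb P A D x - avg (hitProb P A D) x) * hitProb P B D x =
        ∑ x ∈ A, (1 - avg (hitProb P A D) x) * hitProb P B D x := by
    intro A B hAD
    rw [tsum_eq_sum (s := A)]
    · exact Finset.sum_congr rfl fun x hx => by
        rw [hitProb_eq_one hd hP (G := ↑A) (D := D) hx (hAD hx)]
    · intro x hx
      by_cases hxD : x ∈ D
      · have := hitProb_eq_avg hd hP (G := ↑A) (D := D) (x := x) (by simpa using hx) hxD
        rw [← this]; ring
      · rw [hitProb_eq_zero hd hP (G := ↑B) hxD, mul_zero]
  have hfin : ∀ A : Finset (Zd d), (hitProb P A D).support.Finite := fun A =>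
    hD.subset fun x hx => by
      by_contra hxD
      exact hx (hitProb_eq_zero hd hP hxD)
  have h1 := tsum_sub_avg_mul (hfin K) (hitProb P S D)
  rw [key K S hKD] at h1
  rw [h1]
  simp_rw [mul_comm (hitProb P K D _)]
  rw [key S K ((Finset.coe_subset.2 hSK).trans hKD)]
  refine Finset.sum_congr rfl fun x hx => ?_
  rw [hitProb_eq_one hd hP (G := ↑K) (hSK hx) (hKD (hSK hx)), mul_one]

/-- The box of radius `N`. -/
def box (d : ℕ) (N : ℕ) : Set (Zd d) := {x | ∀ i, |x i| ≤ N}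

lemma box_eq_Icc (d N : ℕ) : box d N = Set.Icc (fun _ => -(N : ℤ)) (fun _ => (N : ℤ)) := by
  ext x
  simp [box, Pi.le_def, abs_le, forall_and]

lemma finite_box (d N : ℕ) : (box d N).Finite := by
  rw [box_eq_Icc]; exact Set.finite_Icc _ _

lemma box_mono {d : ℕ} : Monotone (box d) := fun N M h x hx i =>
  (hx i).trans (by exact_mod_cast h)

lemma exists_mem_box {d : ℕ} (x : Zd d) : ∃ N, x ∈ box d N := by
  refine ⟨∑ i, (x i).natAbs, fun i => ?_⟩
  rw [Int.abs_eq_natAbs]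
  exact_mod_cast Finset.single_le_sum (f := fun i => (x i).natAbs) (fun _ _ => Nat.zero_le _)
    (Finset.mem_univ i)

lemma exists_finset_subset_box {d : ℕ} (K : Finset (Zd d)) : ∃ N, ↑K ⊆ box d N := by
  choose f hf using fun x : Zd d => exists_mem_box x
  refine ⟨K.sup f, fun x hx => box_mono (Finset.le_sup (f := f) hx) (hf x)⟩

lemma tendsto_hitProb_box {d : ℕ} {P : Zd d → Measure (ℕ → Zd d)} (hP : IsSRW d P)
    (G : Set (Zd d)) (x : Zd d) :
    Tendsto (fun N => hitProb P G (box d N) x) atTop (nhds (hitProb P G Set.univ x)) := by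
  have := hP.1 x
  have hU : hitIn G Set.univ = ⋃ N, hitIn G (box d N) := by
    ext ω
    simp only [Set.mem_iUnion]
    constructor
    · rintro ⟨n, hn, -⟩
      obtain ⟨N, hN⟩ := exists_finset_subset_box ((Finset.range (n + 1)).image ω)
      exact ⟨N, n, hn, fun k hk => hN (by
        simp only [Finset.coe_image, Finset.coe_range, Set.mem_image, Set.mem_Iio]
        exact ⟨k, by omega, rfl⟩)⟩
    · rintro ⟨N, n, hn, -⟩
      exact ⟨n, hn, fun _ _ => Set.mem_univ _⟩
  unfold hitProb
  rw [hU]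
  refine (ENNReal.tendsto_toReal (measure_ne_top _ _)).comp
    (tendsto_measure_iUnion_atTop ?_)
  rintro N M h ω ⟨n, hn, hk⟩
  exact ⟨n, hn, fun k hkn => box_mono h (hk k hkn)⟩

lemma tendsto_avg {d : ℕ} {f : ℕ → Zd d → ℝ} {g : Zd d → ℝ}
    (h : ∀ y, Tendsto (fun N => f N y) atTop (nhds (g y))) (x : Zd d) :
    Tendsto (fun N => avg (f N) x) atTop (nhds (avg g x)) :=
  (tendsto_finsetSum _ fun _ _ => h _).const_mul _

/-- The sweeping identity. -/
lemma capa_eq_sum_eqm_mul_hitProb {d : ℕ} (hd : 0 < d) {P : Zd d → Measure (ℕ → Zd d)}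
    (hP : IsSRW d P) {S K : Finset (Zd d)} (hSK : S ⊆ K) :
    capa P S = ∑ x ∈ K, eqm P K x * hitProb P S Set.univ x := by
  have hlim1 : Tendsto (fun N => ∑ x ∈ K, (1 - avg (hitProb P K (box d N)) x) *
      hitProb P S (box d N) x) atTop (nhds (∑ x ∈ K, eqm P K x * hitProb P S Set.univ x)) := by
    refine tendsto_finsetSum _ fun x hx => ?_
    rw [eqm_eq hd hP (Finset.mem_coe.2 hx)]
    exact ((tendsto_avg (tendsto_hitProb_box hP _) x).const_sub 1).mul (tendsto_hitProb_box hP _ x)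
  have hlim2 : Tendsto (fun N => ∑ x ∈ S, (1 - avg (hitProb P S (box d N)) x)) atTop
      (nhds (capa P S)) := by
    refine tendsto_finsetSum _ fun x hx => ?_
    rw [eqm_eq hd hP (Finset.mem_coe.2 hx)]
    exact (tendsto_avg (tendsto_hitProb_box hP _) x).const_sub 1
  obtain ⟨N₀, hN₀⟩ := exists_finset_subset_box K
  refine tendsto_nhds_unique (hlim2.congr' ?_) hlim1
  filter_upwards [eventually_ge_atTop N₀] with N hN
  exact (sum_escape_mul_hitProb_finite hd hP (finite_box d N) hSK
    (hN₀.trans (box_mono hN))).symm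

/-- The box of radius `N` as a finite set. -/
noncomputable def fbox (d N : ℕ) : Finset (Zd d) := (finite_box d N).toFinset

lemma mem_fbox {d N : ℕ} {x : Zd d} : x ∈ fbox d N ↔ ∀ i, |x i| ≤ N := by
  simp [fbox, box]

lemma card_fbox (d N : ℕ) : (fbox d N).card = (2 * N + 1) ^ d := by
  have : fbox d N = Fintype.piFinset fun _ : Fin d => Finset.Icc (-(N : ℤ)) N := by
    ext x
    simp [mem_fbox, abs_le]
  rw [this, Fintype.card_piFinset]
  simp only [Int.card_Icc, Finset.prod_const, Finset.card_univ, Fintype.card_fin]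
  congr 1
  omega

/-- The squared Euclidean norm. -/
def sqNorm {d : ℕ} (x : Zd d) : ℝ := ∑ i, (x i : ℝ) ^ 2

lemma sqNorm_add_stepVec {d : ℕ} (x : Zd d) (i : Fin d) (b : Bool) :
    sqNorm (x + stepVec (i, b)) =
      sqNorm x + 1 + (if b then 2 * (x i : ℝ) else -(2 * (x i : ℝ))) := by
  unfold sqNorm
  rw [← Finset.add_sum_erase _ _ (Finset.mem_univ i),
    ← Finset.add_sum_erase Finset.univ (fun j => (x j : ℝ) ^ 2) (Finset.mem_univ i)]
  have : ∑ j ∈ Finset.univ.erase i, (((x + stepVec (i, b)) j : ℤ) : ℝ) ^ 2 =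
      ∑ j ∈ Finset.univ.erase i, (x j : ℝ) ^ 2 :=
    Finset.sum_congr rfl fun j hj => by
      simp [stepVec, Pi.single_eq_of_ne (Finset.ne_of_mem_erase hj)]
  rw [this]
  cases b <;> simp [stepVec] <;> ring

lemma avg_eq_sum_fin {d : ℕ} (f : Zd d → ℝ) (x : Zd d) :
    avg f x = (2 * d : ℝ)⁻¹ *
      ∑ i : Fin d, (f (x + stepVec (i, true)) + f (x + stepVec (i, false))) := by
  simp [avg, Fintype.sum_prod_type]

lemma avg_sqNorm {d : ℕ} (hd : 0 < d) (x : Zd d) : avg sqNorm x = sqNorm x + 1 := by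
  have : (d : ℝ) ≠ 0 := by positivity
  rw [avg_eq_sum_fin]
  simp only [sqNorm_add_stepVec, if_true, Bool.false_eq_true, if_false]
  have h : ∀ i : Fin d, sqNorm x + 1 + 2 * (x i : ℝ) + (sqNorm x + 1 + -(2 * (x i : ℝ))) =
    2 * (sqNorm x + 1) := fun i => by ring
  simp_rw [h]
  simp
  field_simp

lemma capa_fbox_le {d : ℕ} (hd : 0 < d) {P : Zd d → Measure (ℕ → Zd d)}
    (hP : IsSRW d P) (R : ℕ) (hR : 0 < R) :
    capa P (fbox d R) * (d * R ^ 2) ≤ (4 * d * R + 1 : ℝ) ^ d := by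
  set K := fbox d R with hK
  let D : Set (Zd d) := {x | sqNorm x < 2 * d * R ^ 2}
  have hDsub : D ⊆ ↑(fbox d (2 * d * R)) := by
    intro x hx
    rw [Finset.mem_coe, mem_fbox]
    intro i
    have h1 : (x i : ℝ) ^ 2 ≤ sqNorm x :=
      Finset.single_le_sum (f := fun i => (x i : ℝ) ^ 2) (fun _ _ => sq_nonneg _)
        (Finset.mem_univ i)
    have h2 : sqNorm x < 2 * d * R ^ 2 := hx
    have hd1 : (1 : ℝ) ≤ d := by exact_mod_cast hd
    have h3 : |(x i : ℝ)| ≤ 2 * d * R := by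
      apply abs_le_of_sq_le_sq _ (by positivity)
      have : (2 * d * R : ℝ) ^ 2 = 2 * d * R ^ 2 * (2 * d) := by ring
      rw [this]
      have : (0 : ℝ) ≤ 2 * d * R ^ 2 := by positivity
      nlinarith
    exact_mod_cast h3
  have hDfin : D.Finite := (Finset.finite_toSet _).subset hDsub
  have hKD : ↑K ⊆ D := by
    intro x hx
    have hx' := mem_fbox.1 (Finset.mem_coe.1 hx)
    change sqNorm x < _
    have : sqNorm x ≤ ∑ _i : Fin d, (R : ℝ) ^ 2 := Finset.sum_le_sum fun i _ => by
      apply sq_le_sq.2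
      rw [abs_of_nonneg (a := (R : ℝ)) (by positivity)]
      exact_mod_cast hx' i
    simp at this
    have hpos : (0 : ℝ) < d * R ^ 2 := by positivity
    linarith
  set h := hitProb P (↑K) D with hh
  have hsupp : h.support ⊆ D := fun x hx => by
    by_contra hxD
    exact hx (hitProb_eq_zero hd hP hxD)
  let q : Zd d → ℝ := fun x => 2 * d * R ^ 2 - sqNorm x
  have hq : ∀ x, q x - avg q x = 1 := fun x => by
    have h1 : avg q x = 2 * d * R ^ 2 - avg sqNorm x := by
      have h1 := avg_const hd (2 * d * R ^ 2 : ℝ) x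
      simp only [avg, q, Finset.sum_sub_distrib, mul_sub] at h1 ⊢
      rw [h1]
    rw [h1, avg_sqNorm hd]
    simp only [q]; ring
  have hkey := tsum_sub_avg_mul (hDfin.subset hsupp) q
  have hR' : ∑' x, h x * (q x - avg q x) ≤ (4 * d * R + 1 : ℝ) ^ d := by
    simp_rw [hq, mul_one]
    rw [tsum_eq_sum (s := fbox d (2 * d * R))]
    · calc ∑ x ∈ fbox d (2 * d * R), h x ≤ ∑ x ∈ fbox d (2 * d * R), (1 : ℝ) :=
            Finset.sum_le_sum fun x _ => hitProb_le_one hP _ _ x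
        _ = _ := by
            rw [Finset.sum_const, card_fbox]; simp; ring
    · intro x hx
      exact hitProb_eq_zero hd hP fun hxD => hx (hDsub hxD)
  have hnn : ∀ x, 0 ≤ (h x - avg h x) * q x := by
    intro x
    by_cases hxD : x ∈ D
    · refine mul_nonneg ?_ (sub_nonneg.2 (le_of_lt hxD))
      by_cases hxK : x ∈ K
      · rw [hh, hitProb_eq_one hd hP (G := ↑K) hxK hxD, sub_nonneg]
        exact (avg_mono (fun y => hitProb_le_one hP _ _ y) x).trans (avg_const hd 1 x).le
      · rw [sub_nonneg]
        exact (hitProb_eq_avg hd hP (G := ↑K) (by simpa using hxK) hxD).ge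
    · have h0 : h x = 0 := hitProb_eq_zero hd hP hxD
      have h1 : 0 ≤ avg h x := avg_nonneg (fun y => hitProb_nonneg _ _ _ _) x
      have h2 : q x ≤ 0 := sub_nonpos.2 (not_lt.1 hxD)
      rw [h0]
      nlinarith
  have hsum : Summable fun x => (h x - avg h x) * q x := by
    by_contra hcon
    apply hcon
    have hfin : (D ∪ ⋃ e : Fin d × Bool, (· + stepVec e) ⁻¹' D).Finite :=
      hDfin.union (Set.finite_iUnion fun e => hDfin.preimage ((add_left_injective _).injOn))
    refine summable_of_hasFiniteSupport (hfin.subset fun x hx => ?_)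
    have hx' := left_ne_zero_of_mul hx
    by_contra hc
    simp only [Set.mem_union, Set.mem_iUnion, Set.mem_preimage, not_or, not_exists] at hc
    apply hx'
    have h0 : h x = 0 := hitProb_eq_zero hd hP hc.1
    have h1 : avg h x = 0 := by
      unfold avg
      rw [Finset.sum_eq_zero fun e _ => hitProb_eq_zero hd hP (hc.2 e), mul_zero]
    rw [h0, h1, sub_zero]
  have hL : capa P K * (d * R ^ 2) ≤ ∑' x, (h x - avg h x) * q x := by
    refine le_trans ?_ (hsum.sum_le_tsum K fun x _ => hnn x)
    unfold capa
    rw [Finset.sum_mul]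
    refine Finset.sum_le_sum fun x hx => ?_
    have hxK : x ∈ (↑K : Set (Zd d)) := hx
    have he : eqm P K x ≤ h x - avg h x := by
      rw [eqm_eq hd hP hxK, hh, hitProb_eq_one hd hP hxK (hKD hxK)]
      exact sub_le_sub_left (avg_mono (fun y => hitProb_mono hP (Set.subset_univ D) y) x) _
    have hqx : (d * R ^ 2 : ℝ) ≤ q x := by
      have hx' := mem_fbox.1 hx
      have : sqNorm x ≤ ∑ _i : Fin d, (R : ℝ) ^ 2 := Finset.sum_le_sum fun i _ => by
        apply sq_le_sq.2
        rw [abs_of_nonneg (a := (R : ℝ)) (by positivity)]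
        exact_mod_cast hx' i
      simp at this
      simp only [q]
      linarith
    have h0 := eqm_nonneg P (↑K) x
    exact mul_le_mul he hqx (by positivity) (h0.trans he)
  linarith

/-- Every set of the family `G` indexed by `R` is visited. -/
def hitAll {d : ℕ} {β : Type*} (G : β → Set (Zd d)) (R : Finset β) : Set (ℕ → Zd d) :=
  {ω | ∀ b ∈ R, ∃ n, ω n ∈ G b}

lemma measurableSet_hitAll {d : ℕ} {β : Type*} (G : β → Set (Zd d)) (R : Finset β) :
    MeasurableSet (hitAll G R) := by
  have : hitAll G R = ⋂ b ∈ R, ⋃ n, {ω : ℕ → Zd d | ω n ∈ G b} := by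
    ext ω; simp [hitAll]
  rw [this]
  exact Finset.measurableSet_biInter _ fun b _ =>
    MeasurableSet.iUnion fun n => measurableSet_coord n _

/-- The paths that visit `G` by time `n` and whose shift at such a time belongs to `E`. -/
def thenIn {d : ℕ} (G : Set (Zd d)) (E : Set (ℕ → Zd d)) (n : ℕ) : Set (ℕ → Zd d) :=
  {ω | ∃ t ≤ n, ω t ∈ G ∧ (fun k => ω (t + k)) ∈ E}

lemma measurableSet_thenIn {d : ℕ} (G : Set (Zd d)) {E : Set (ℕ → Zd d)}
    (hE : MeasurableSet E) (n : ℕ) : MeasurableSet (thenIn G E n) := by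
  have : thenIn G E n = ⋃ t ∈ Set.Iic n, ({ω : ℕ → Zd d | ω t ∈ G} ∩
      (fun ω : ℕ → Zd d => fun k => ω (t + k)) ⁻¹' E) := by
    ext ω
    simp only [thenIn, Set.mem_ofPred_eq, Set.mem_iUnion, Set.mem_inter_iff, Set.mem_preimage,
      Set.mem_Iic, exists_prop]
  rw [this]
  refine MeasurableSet.biUnion (Set.to_countable _) fun t _ => (measurableSet_coord t G).inter ?_
  exact hE.preimage (measurable_pi_lambda _ fun k => measurable_pi_apply _)

/-- A form of the strong Markov property at the hitting time of `G`, for shift-monotone events: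
the hitting probability is controlled by a superharmonic function. -/
lemma real_thenIn_le {d : ℕ} (hd : 0 < d) {P : Zd d → Measure (ℕ → Zd d)} (hP : IsSRW d P)
    {G : Set (Zd d)} {E : Set (ℕ → Zd d)} (hE : MeasurableSet E)
    (hmono : ∀ x ω, ω ∈ E → pcons x ω ∈ E) {ψ : Zd d → ℝ} (hψ0 : ∀ x, 0 ≤ ψ x)
    (hψ : ∀ x, avg ψ x ≤ ψ x) (hψG : ∀ x ∈ G, 1 ≤ ψ x) {M : ℝ} (hM : 0 ≤ M)
    (hEM : ∀ x ∈ G, (P x).real E ≤ M) (n : ℕ) (z : Zd d) :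
    (P z).real (thenIn G E n) ≤ ψ z * M := by
  have := hP.1
  have hmono' : ∀ (t : ℕ) (ω : ℕ → Zd d), (fun k => ω (t + k)) ∈ E → ω ∈ E := by
    intro t
    induction t with
    | zero => intro ω h; simpa using h
    | succ t ih =>
      intro ω h
      apply ih
      have := hmono (ω t) _ h
      convert this using 1
      ext k : 1
      cases k with
      | zero => rfl
      | succ k => simp only [pcons]; congr 1; omega
  have hG : ∀ n, ∀ z ∈ G, (P z).real (thenIn G E n) ≤ ψ z * M := by
    intro n z hz
    calc (P z).real (thenIn G E n) ≤ (P z).real E := by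
          refine measureReal_mono ?_
          rintro ω ⟨t, -, -, h⟩
          exact hmono' t ω h
      _ ≤ 1 * M := by rw [one_mul]; exact hEM z hz
      _ ≤ _ := by gcongr; exact hψG z hz
  induction n generalizing z with
  | zero =>
    by_cases hz : z ∈ G
    · exact hG 0 z hz
    · rw [hP.real_congr hd z (measurableSet_thenIn G hE 0) MeasurableSet.empty]
      · simpa using mul_nonneg (hψ0 z) hM
      · intro ω
        simp [thenIn, pcons, hz]
  | succ n ih =>
    by_cases hz : z ∈ G
    · exact hG _ z hz
    · rw [hP.first_step_avg hd z (B := thenIn G E n) (measurableSet_thenIn G hE (n + 1))]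
      · calc avg (fun y => (P y).real (thenIn G E n)) z ≤ avg (fun y => M * ψ y) z :=
              avg_mono (fun y => by rw [mul_comm]; exact ih y) z
          _ = M * avg ψ z := avg_const_mul _ _ _
          _ ≤ M * ψ z := by gcongr; exact hψ z
          _ = _ := mul_comm _ _
      · intro ω
        have hs : ∀ t, (fun k => pcons z ω (t + 1 + k)) = fun k => ω (t + k) := fun t => by
          ext k : 1
          rw [show t + 1 + k = (t + k) + 1 by ring]; rfl
        constructor
        · rintro ⟨t, ht, h1, h2⟩
          cases t with
          | zero => exact absurd h1 hz
          | succ t =>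
            rw [hs] at h2
            exact ⟨t, by omega, h1, h2⟩
        · rintro ⟨t, ht, h1, h2⟩
          refine ⟨t + 1, by omega, h1, ?_⟩
          rw [hs]; exact h2

lemma real_hitAll_le_sum {d : ℕ} (hd : 0 < d) {P : Zd d → Measure (ℕ → Zd d)} (hP : IsSRW d P)
    {β : Type*} [DecidableEq β] (G : β → Set (Zd d)) {R : Finset β} (hR : R.Nonempty)
    {ψ : β → Zd d → ℝ} (hψ0 : ∀ b x, 0 ≤ ψ b x)
    (hψ : ∀ b x, avg (ψ b) x ≤ ψ b x) (hψG : ∀ b, ∀ x ∈ G b, 1 ≤ ψ b x)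
    {M : β → ℝ} (hM : ∀ b ∈ R, 0 ≤ M b)
    (hEM : ∀ b ∈ R, ∀ x ∈ G b, (P x).real (hitAll G (R.erase b)) ≤ M b) (z : Zd d) :
    (P z).real (hitAll G R) ≤ ∑ b ∈ R, ψ b z * M b := by
  have := hP.1
  have hmono : ∀ R : Finset β, ∀ x ω, ω ∈ hitAll G R → pcons x ω ∈ hitAll G R := by
    intro R x ω h b hb
    obtain ⟨n, hn⟩ := h b hb
    exact ⟨n + 1, hn⟩
  have hsub : hitAll G R ⊆ ⋃ b ∈ R, ⋃ n, thenIn (G b) (hitAll G (R.erase b)) n := by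
    intro ω hω
    classical
    let τ : β → ℕ := fun b => if h : ∃ n, ω n ∈ G b then Nat.find h else 0
    have hτ : ∀ b ∈ R, ω (τ b) ∈ G b := fun b hb => by
      have h := hω b hb
      simp only [τ, dif_pos h]
      exact Nat.find_spec h
    obtain ⟨b, hb, hmin⟩ := R.exists_min_image τ hR
    simp only [Set.mem_iUnion]
    refine ⟨b, hb, τ b, τ b, le_rfl, hτ b hb, fun c hc => ?_⟩
    have hcR := Finset.mem_of_mem_erase hc
    refine ⟨τ c - τ b, ?_⟩
    have := hmin c hcR
    simp only [Nat.add_sub_cancel' this]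
    exact hτ c hcR
  calc (P z).real (hitAll G R)
      ≤ (P z).real (⋃ b ∈ R, ⋃ n, thenIn (G b) (hitAll G (R.erase b)) n) :=
        measureReal_mono hsub (measure_ne_top _ _)
    _ ≤ ∑ b ∈ R, (P z).real (⋃ n, thenIn (G b) (hitAll G (R.erase b)) n) :=
        measureReal_biUnion_finset_le _ _
    _ ≤ _ := by
      refine Finset.sum_le_sum fun b hb => ?_
      have hlim : Tendsto (fun n => (P z).real (thenIn (G b) (hitAll G (R.erase b)) n)) atTop
          (nhds ((P z).real (⋃ n, thenIn (G b) (hitAll G (R.erase b)) n))) := by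
        refine (ENNReal.tendsto_toReal (measure_ne_top _ _)).comp
          (tendsto_measure_iUnion_atTop ?_)
        rintro n m h ω ⟨t, ht, h1, h2⟩
        exact ⟨t, ht.trans h, h1, h2⟩
      refine le_of_tendsto' hlim fun n => ?_
      exact real_thenIn_le hd hP (measurableSet_hitAll _ _) (hmono _) (hψ0 b) (hψ b) (hψG b)
        (hM b hb) (hEM b hb) n z

/-- A positive superharmonic function on `ℤ^d`, `d ≥ 3`, decaying like `1/|x|`. -/
noncomputable def invNorm {d : ℕ} (x : Zd d) : ℝ := (√(sqNorm x + 7))⁻¹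

lemma sqNorm_nonneg {d : ℕ} (x : Zd d) : 0 ≤ sqNorm x := Finset.sum_nonneg fun _ _ => sq_nonneg _

lemma sq_le_sqNorm {d : ℕ} (x : Zd d) (i : Fin d) : (x i : ℝ) ^ 2 ≤ sqNorm x :=
  Finset.single_le_sum (f := fun i => (x i : ℝ) ^ 2) (fun _ _ => sq_nonneg _) (Finset.mem_univ i)

lemma invNorm_nonneg {d : ℕ} (x : Zd d) : 0 ≤ invNorm x := by unfold invNorm; positivity

lemma inv_sqrt_one_sub_le {v : ℝ} (h0 : 0 ≤ v) (h1 : v ≤ 1 / 2) :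
    (√(1 - v))⁻¹ ≤ 1 + v / 2 + v ^ 2 := by
  have hv : 0 < √(1 - v) := Real.sqrt_pos.2 (by linarith)
  rw [inv_le_comm₀ hv (by positivity)]
  apply Real.le_sqrt_of_sq_le
  rw [inv_pow, inv_le_iff_one_le_mul₀ (by positivity)]
  have h3 : 0 ≤ v ^ 2 * (1 - v) := by have : 0 ≤ 1 - v := by linarith
                                      positivity
  have h4 : v ^ 5 ≤ v ^ 2 * (1 / 2) ^ 3 := by
    have := pow_le_pow_left₀ h0 h1 3
    calc v ^ 5 = v ^ 2 * v ^ 3 := by ring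
      _ ≤ _ := by gcongr
  nlinarith [sq_nonneg v]

lemma inv_sqrt_add_inv_sqrt_le {s a : ℝ} (hs : 0 < s) (ha : a ^ 2 / s ^ 2 ≤ 1 / 2) :
    (√(s + a))⁻¹ + (√(s + -a))⁻¹ ≤
      (√s)⁻¹ * (2 + 3 / 4 * (a ^ 2 / s ^ 2) + 3 / 2 * (a ^ 2 / s ^ 2) ^ 2) := by
  set v := a ^ 2 / s ^ 2 with hv
  have hv0 : 0 ≤ v := by positivity
  have hav : a ^ 2 = v * s ^ 2 := by rw [hv]; field_simp
  have habs : |a| < s := by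
    apply abs_lt_of_sq_lt_sq _ hs.le
    rw [hav]; nlinarith [sq_pos_of_pos hs]
  obtain ⟨h1, h2⟩ := abs_lt.1 habs
  have hp : 0 < s + a := by linarith
  have hm : 0 < s + -a := by linarith
  have hprod : (s + a) * (s + -a) = s ^ 2 * (1 - v) := by linear_combination -hav
  have hv1 : 0 < 1 - v := by linarith
  apply le_of_sq_le_sq _ (by positivity)
  have e1 : ((√(s + a))⁻¹ + (√(s + -a))⁻¹) ^ 2 = s⁻¹ * (2 * (1 - v)⁻¹ + 2 * (√(1 - v))⁻¹) := by
    rw [add_sq, inv_pow, inv_pow, Real.sq_sqrt hp.le, Real.sq_sqrt hm.le, mul_assoc,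
      ← mul_inv, ← Real.sqrt_mul hp.le, hprod, Real.sqrt_mul (by positivity), Real.sqrt_sq hs.le,
      mul_inv]
    have : (s + a)⁻¹ + (s + -a)⁻¹ = 2 * s⁻¹ * (1 - v)⁻¹ := by
      rw [inv_add_inv hp.ne' hm.ne', hprod]; field_simp; ring_nf
    linear_combination this
  have e2 : ((√s)⁻¹ * (2 + 3 / 4 * v + 3 / 2 * v ^ 2)) ^ 2 =
      s⁻¹ * (2 + 3 / 4 * v + 3 / 2 * v ^ 2) ^ 2 := by
    rw [mul_pow, inv_pow, Real.sq_sqrt hs.le]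
  rw [e1, e2]
  gcongr
  have h3 := inv_sqrt_one_sub_le hv0 ha
  have h4 : (1 - v)⁻¹ ≤ 1 + v + 2 * v ^ 2 := by
    rw [inv_le_iff_one_le_mul₀ hv1]
    nlinarith [sq_nonneg v]
  have h5 : 0 ≤ v ^ 3 := by positivity
  have h6 : 0 ≤ v ^ 4 := by positivity
  nlinarith [sq_nonneg v]

lemma avg_invNorm_le {d : ℕ} (hd : 3 ≤ d) (x : Zd d) : avg invNorm x ≤ invNorm x := by
  have hd' : (3 : ℝ) ≤ d := by exact_mod_cast hd
  have hx := sqNorm_nonneg x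
  set s := sqNorm x + 8 with hs
  have hs8 : 8 ≤ s := by linarith
  have hs0 : 0 < s := by linarith
  let v : Fin d → ℝ := fun i => (2 * (x i : ℝ)) ^ 2 / s ^ 2
  have hv0 : ∀ i, 0 ≤ v i := fun i => by positivity
  have hvi : ∀ i, v i ≤ 1 / 2 := fun i => by
    have := sq_le_sqNorm x i
    simp only [v]
    rw [div_le_iff₀ (by positivity)]
    nlinarith
  have hV : ∑ i, v i = 4 * sqNorm x / s ^ 2 := by
    simp only [v, sqNorm, ← Finset.sum_div, Finset.mul_sum]
    congr 1
    exact Finset.sum_congr rfl fun i _ => by ring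
  set V := ∑ i, v i with hVdef
  have hV0 : 0 ≤ V := Finset.sum_nonneg fun i _ => hv0 i
  have hV2 : ∑ i, v i ^ 2 ≤ V ^ 2 := Finset.sum_sq_le_sq_sum_of_nonneg fun i _ => hv0 i
  have hterm : ∀ i, invNorm (x + stepVec (i, true)) + invNorm (x + stepVec (i, false)) ≤
      (√s)⁻¹ * (2 + 3 / 4 * v i + 3 / 2 * v i ^ 2) := fun i => by
    unfold invNorm
    rw [sqNorm_add_stepVec, sqNorm_add_stepVec]
    convert inv_sqrt_add_inv_sqrt_le hs0 (hvi i) using 4 <;> simp <;> rw [hs] <;> ring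
  rw [avg_eq_sum_fin]
  have h1 : (2 * d : ℝ)⁻¹ *
      ∑ i : Fin d, (invNorm (x + stepVec (i, true)) + invNorm (x + stepVec (i, false))) ≤
      (√s)⁻¹ * (1 + V / 8 + V ^ 2 / 4) := by
    calc _ ≤ (2 * d : ℝ)⁻¹ * ∑ i : Fin d, (√s)⁻¹ * (2 + 3 / 4 * v i + 3 / 2 * v i ^ 2) := by
          gcongr with i; exact hterm i
      _ = (2 * d : ℝ)⁻¹ * ((√s)⁻¹ * (2 * d + 3 / 4 * V + 3 / 2 * ∑ i, v i ^ 2)) := by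
          rw [← Finset.mul_sum, Finset.sum_add_distrib, Finset.sum_add_distrib,
            ← Finset.mul_sum, ← Finset.mul_sum, hVdef]
          simp only [Finset.sum_const, Finset.card_univ, Fintype.card_fin, nsmul_eq_mul]
          ring
      _ ≤ (2 * d : ℝ)⁻¹ * ((√s)⁻¹ * (2 * d + 3 / 4 * V + 3 / 2 * V ^ 2)) := by gcongr
      _ = (√s)⁻¹ * (1 + 3 / 8 * (V / d) + 3 / 4 * (V ^ 2 / d)) := by field_simp; ring
      _ ≤ (√s)⁻¹ * (1 + 3 / 8 * (V / 3) + 3 / 4 * (V ^ 2 / 3)) := by gcongr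
      _ = _ := by ring
  refine h1.trans ?_
  have h2 : 1 + V / 8 + V ^ 2 / 4 ≤ 1 + 1 / (2 * s) := by
    have h3 : V ^ 2 ≤ 16 / s ^ 2 := by
      have : V ≤ 4 / s := by
        rw [hV, div_le_div_iff₀ (by positivity) hs0]; nlinarith
      calc V ^ 2 ≤ (4 / s) ^ 2 := by gcongr
        _ = _ := by rw [div_pow]; norm_num
    have h4 : V / 8 = 1 / (2 * s) - 4 / s ^ 2 := by
      rw [hV, show sqNorm x = s - 8 by rw [hs]; ring]; field_simp; ring
    have h5 : 16 / s ^ 2 = 4 * (4 / s ^ 2) := by ring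
    linarith
  calc (√s)⁻¹ * (1 + V / 8 + V ^ 2 / 4) ≤ (√s)⁻¹ * (1 + 1 / (2 * s)) := by gcongr
    _ ≤ invNorm x := by
      unfold invNorm
      have hs1 : sqNorm x + 7 = s - 1 := by rw [hs]; ring
      rw [hs1]
      have hsm : 0 < s - 1 := by linarith
      apply le_of_sq_le_sq _ (by positivity)
      rw [mul_pow, inv_pow, inv_pow, Real.sq_sqrt hs0.le, Real.sq_sqrt hsm.le]
      have : (1 + 1 / (2 * s)) ^ 2 = (2 * s + 1) ^ 2 / (2 * s) ^ 2 := by field_simp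
      rw [this, inv_mul_eq_div, div_div, inv_eq_one_div, div_le_div_iff₀ (by positivity) hsm]
      nlinarith

lemma avg_comp_sub {d : ℕ} (f : Zd d → ℝ) (q x : Zd d) :
    avg (fun z => f (z - q)) x = avg f (x - q) := by
  simp [avg, add_sub_right_comm]

lemma avg_sum {d : ℕ} {ι : Type*} (s : Finset ι) (f : ι → Zd d → ℝ) (x : Zd d) :
    avg (fun z => ∑ q ∈ s, f q z) x = ∑ q ∈ s, avg (f q) x := by
  simp only [avg, ← Finset.mul_sum]
  rw [Finset.sum_comm]

lemma invNorm_le {d : ℕ} {x : Zd d} {i : Fin d} {D : ℝ} (hD : 0 < D) (h : D ≤ |(x i : ℝ)|) :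
    invNorm x ≤ 1 / D := by
  unfold invNorm
  rw [one_div]
  gcongr
  apply Real.le_sqrt_of_sq_le
  have := sq_le_sqNorm x i
  have h2 : D ^ 2 ≤ (x i : ℝ) ^ 2 := by rw [← sq_abs (x i : ℝ)]; gcongr
  linarith

/-- The sum over `q ∈ T` of the translates by `q` of `invNorm`. -/
noncomputable def potential {d : ℕ} {ι : Type*} (T : Finset ι) (q : ι → Zd d) (z : Zd d) : ℝ :=
  ∑ t ∈ T, invNorm (z - q t)

lemma avg_potential_le {d : ℕ} (hd : 3 ≤ d) {ι : Type*} (T : Finset ι) (q : ι → Zd d)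
    (z : Zd d) : avg (potential T q) z ≤ potential T q z := by
  unfold potential
  rw [avg_sum]
  refine Finset.sum_le_sum fun t _ => ?_
  rw [avg_comp_sub invNorm]
  exact avg_invNorm_le hd _

lemma potential_nonneg {d : ℕ} {ι : Type*} (T : Finset ι) (q : ι → Zd d)
    (z : Zd d) : 0 ≤ potential T q z := Finset.sum_nonneg fun _ _ => invNorm_nonneg _

lemma potential_le {d : ℕ} {ι : Type*} {T : Finset ι} {q : ι → Zd d}
    {z : Zd d} {D : ℝ} (hD : 0 < D) (h : ∀ t ∈ T, ∃ i, D ≤ |((z i - q t i : ℤ) : ℝ)|) :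
    potential T q z ≤ T.card / D := by
  unfold potential
  calc _ ≤ ∑ t ∈ T, 1 / D := Finset.sum_le_sum fun t ht => by
        obtain ⟨i, hi⟩ := h t ht
        exact invNorm_le hD (i := i) hi
    _ = _ := by simp [div_eq_mul_inv]

/-- The point of the plane `ℤ e₁ + ℤ e₂` with coordinates `a` and `b`. -/
def planePt (d : ℕ) (a b : ℤ) : Zd d :=
  fun i => if (i : ℕ) = 0 then a else if (i : ℕ) = 1 then b else 0

lemma planePt_zero {d : ℕ} (hd : 3 ≤ d) (a b : ℤ) : planePt d a b ⟨0, by omega⟩ = a := by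
  simp [planePt]

lemma planePt_one {d : ℕ} (hd : 3 ≤ d) (a b : ℤ) : planePt d a b ⟨1, by omega⟩ = b := by
  simp [planePt]

lemma planePt_sub {d : ℕ} (a b a' b' : ℤ) :
    planePt d a b - planePt d a' b' = planePt d (a - a') (b - b') := by
  ext i
  simp only [planePt, Pi.sub_apply]
  split_ifs <;> simp

lemma abs_planePt_le {d : ℕ} {a b : ℤ} {D : ℤ} (ha : |a| ≤ D) (hb : |b| ≤ D) (i : Fin d) :
    |planePt d a b i| ≤ D := by
  have : 0 ≤ D := (abs_nonneg _).trans ha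
  simp only [planePt]
  split_ifs <;> simp_all

lemma sqNorm_planePt_le {d : ℕ} (a b : ℤ) :
    sqNorm (planePt d a b) ≤ (a : ℝ) ^ 2 + (b : ℝ) ^ 2 := by
  have hle : ∀ n : ℕ, ∀ c : ℝ, 0 ≤ c → (∑ i : Fin d, if (i : ℕ) = n then c else 0) ≤ c := by
    intro n c hc
    rw [← Finset.sum_filter, Finset.sum_const, nsmul_eq_mul]
    have : (Finset.univ.filter fun i : Fin d => (i : ℕ) = n).card ≤ 1 := by
      rw [Finset.card_le_one]
      intro i hi j hj
      simp only [Finset.mem_filter, Finset.mem_univ, true_and] at hi hj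
      exact Fin.ext (hi.trans hj.symm)
    have h2 : ((Finset.univ.filter fun i : Fin d => (i : ℕ) = n).card : ℝ) ≤ 1 := by
      exact_mod_cast this
    nlinarith
  have : sqNorm (planePt d a b) = (∑ i : Fin d, if (i : ℕ) = 0 then (a : ℝ) ^ 2 else 0) +
      ∑ i : Fin d, if (i : ℕ) = 1 then (b : ℝ) ^ 2 else 0 := by
    rw [← Finset.sum_add_distrib]
    refine Finset.sum_congr rfl fun i _ => ?_
    simp only [planePt]
    split_ifs with h1 h2 <;> simp_all
  rw [this]
  exact add_le_add (hle _ _ (sq_nonneg _)) (hle _ _ (sq_nonneg _))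

/-- The points of the plane at sup-distance `r` from `planePt d c y`. -/
def sqRing (d : ℕ) (c y : ℤ) (r : ℕ) : Set (Zd d) :=
  {z | ∃ a b : ℤ, z = planePt d (c + a) (y + b) ∧ max |a| |b| = r}

/-- The index set of the four sides of a ring. -/
noncomputable def sideIdx (r : ℕ) : Finset (Bool × Bool × ℤ) :=
  Finset.univ ×ˢ Finset.univ ×ˢ Finset.Icc (-(r : ℤ)) r

/-- The points of the four sides of a ring. -/
def sidePt (d : ℕ) (c y : ℤ) (r : ℕ) (t : Bool × Bool × ℤ) : Zd d :=
  if t.1 then planePt d (c + if t.2.1 then (r : ℤ) else -r) (y + t.2.2)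
  else planePt d (c + t.2.2) (y + if t.2.1 then (r : ℤ) else -r)

/-- A nonnegative superharmonic function, at least `1` on the ring of radius `r`. -/
noncomputable def ringFn (d : ℕ) (c y : ℤ) (r : ℕ) (z : Zd d) : ℝ :=
  if r = 0 then 3 * invNorm (z - planePt d c y)
  else 3 / Real.log r * potential (sideIdx r) (sidePt d c y r) z

lemma ringFn_nonneg (d : ℕ) (c y : ℤ) (r : ℕ) (z : Zd d) : 0 ≤ ringFn d c y r z := by
  unfold ringFn
  split_ifs
  · exact mul_nonneg (by norm_num) (invNorm_nonneg _)
  · exact mul_nonneg (div_nonneg (by norm_num) (Real.log_natCast_nonneg r)) (potential_nonneg _ _ _)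

lemma avg_ringFn_le {d : ℕ} (hd : 3 ≤ d) (c y : ℤ) (r : ℕ) (z : Zd d) :
    avg (ringFn d c y r) z ≤ ringFn d c y r z := by
  by_cases hr : r = 0
  · have : ringFn d c y r = fun z => 3 * invNorm (z - planePt d c y) := by
      ext z; simp [ringFn, hr]
    rw [this, avg_const_mul, avg_comp_sub invNorm]
    exact mul_le_mul_of_nonneg_left (avg_invNorm_le hd _) (by norm_num)
  · have : ringFn d c y r =
        fun z => 3 / Real.log r * potential (sideIdx r) (sidePt d c y r) z := by
      ext z; simp [ringFn, hr]
    rw [this, avg_const_mul]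
    exact mul_le_mul_of_nonneg_left (avg_potential_le hd _ _ _)
      (div_nonneg (by norm_num) (Real.log_natCast_nonneg r))

lemma log_le_sum_Icc {r : ℕ} (hr : 0 < r) {b : ℤ} (hb : |b| ≤ r) {f : ℤ → ℝ} (hf : ∀ t, 0 ≤ f t)
    (h : ∀ t, t ≠ b → 1 / (3 * |((b - t : ℤ) : ℝ)|) ≤ f t) :
    Real.log r / 3 ≤ ∑ t ∈ Finset.Icc (-(r : ℤ)) r, f t := by
  obtain ⟨hb1, hb2⟩ := abs_le.1 hb
  let g : ℕ → ℤ := fun k => if 0 ≤ b then b - (k + 1) else b + (k + 1)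
  have hg : Function.Injective g := by
    intro k l hkl
    simp only [g] at hkl
    split_ifs at hkl <;> omega
  have hgabs : ∀ k, |((b - g k : ℤ) : ℝ)| = k + 1 := by
    intro k
    have : |b - g k| = k + 1 := by
      simp only [g]
      split_ifs
      · rw [abs_of_nonneg] <;> omega
      · rw [abs_of_nonpos] <;> omega
    rw [← Int.cast_abs, this]; push_cast; ring
  calc Real.log r / 3 ≤ Real.log (r + 1) / 3 := by
        have : (0 : ℝ) < r := by exact_mod_cast hr
        gcongr; linarith
    _ ≤ (harmonic r : ℝ) / 3 := by
        gcongr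
        exact_mod_cast log_add_one_le_harmonic r
    _ = ∑ k ∈ Finset.range r, 1 / (3 * |((b - g k : ℤ) : ℝ)|) := by
        simp_rw [hgabs]
        rw [harmonic, Rat.cast_sum, Finset.sum_div]
        refine Finset.sum_congr rfl fun k _ => ?_
        push_cast
        have : (k : ℝ) + 1 ≠ 0 := by positivity
        field_simp
    _ ≤ ∑ k ∈ Finset.range r, f (g k) := by
        refine Finset.sum_le_sum fun k _ => h _ fun hk => ?_
        have := hgabs k
        rw [hk] at this
        simp at this
        have : (0 : ℝ) < k + 1 := by positivity
        linarith
    _ = ∑ t ∈ (Finset.range r).image g, f t := (Finset.sum_image (hg.injOn)).symm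
    _ ≤ _ := by
        refine Finset.sum_le_sum_of_subset_of_nonneg ?_ fun t _ _ => hf t
        intro t ht
        obtain ⟨k, hk, rfl⟩ := Finset.mem_image.1 ht
        have hk' := Finset.mem_range.1 hk
        rw [Finset.mem_Icc]
        simp only [g]
        split_ifs <;> omega

lemma le_invNorm_planePt {d : ℕ} {a b : ℤ} (t : ℤ) (ht : t ≠ 0)
    (h : (a : ℝ) ^ 2 + (b : ℝ) ^ 2 = (t : ℝ) ^ 2) :
    1 / (3 * |(t : ℝ)|) ≤ invNorm (planePt d a b) := by
  have h1 : (1 : ℝ) ≤ |(t : ℝ)| := by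
    rw [← Int.cast_abs]; exact_mod_cast Int.one_le_abs ht
  unfold invNorm
  rw [one_div]
  have := sqNorm_nonneg (planePt d a b)
  gcongr
  apply Real.sqrt_le_iff.2 ⟨by positivity, ?_⟩
  have h2 := sqNorm_planePt_le (d := d) a b
  rw [mul_pow, sq_abs, ← h]
  have h3 : 1 ≤ (t : ℝ) ^ 2 := by rw [← sq_abs]; nlinarith
  linarith

lemma one_le_ringFn {d : ℕ} (c y : ℤ) {r : ℕ} (hr : r = 0 ∨ 2 ≤ r) {z : Zd d}
    (hz : z ∈ sqRing d c y r) : 1 ≤ ringFn d c y r z := by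
  obtain ⟨a, b, rfl, hab⟩ := hz
  rcases hr with rfl | hr
  · have ha : a = 0 := by
      have := le_max_left |a| |b|
      rw [hab] at this
      simpa using this
    have hb : b = 0 := by
      have := le_max_right |a| |b|
      rw [hab] at this
      simpa using this
    subst ha hb
    have h0 : sqNorm (0 : Zd d) = 0 := by simp [sqNorm]
    simp only [ringFn, if_true, add_zero, sub_self, invNorm, h0, zero_add]
    rw [← div_eq_mul_inv, le_div_iff₀ (by positivity), one_mul]
    exact Real.sqrt_le_iff.2 ⟨by norm_num, by norm_num⟩
  · have hlog : 0 < Real.log r := Real.log_pos (by exact_mod_cast hr)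
    have ha : |a| ≤ r := hab ▸ le_max_left _ _
    have hb : |b| ≤ r := hab ▸ le_max_right _ _
    have hr0 : r ≠ 0 := by omega
    simp only [ringFn, if_neg hr0]
    rw [div_mul_eq_mul_div, le_div_iff₀ hlog, one_mul]
    suffices h : Real.log r / 3 ≤ potential (sideIdx r) (sidePt d c y r)
        (planePt d (c + a) (y + b)) by linarith
    have key : ∀ σ ε : Bool, ∑ t ∈ Finset.Icc (-(r : ℤ)) r,
        invNorm (planePt d (c + a) (y + b) - sidePt d c y r (σ, ε, t)) ≤
        potential (sideIdx r) (sidePt d c y r) (planePt d (c + a) (y + b)) := by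
      intro σ ε
      unfold potential sideIdx
      rw [Finset.sum_product]
      refine le_trans ?_ (Finset.single_le_sum (f := fun σ => _)
        (fun _ _ => Finset.sum_nonneg fun _ _ => invNorm_nonneg _) (Finset.mem_univ σ))
      rw [Finset.sum_product]
      exact (Finset.single_le_sum (f := fun ε => ∑ t ∈ Finset.Icc (-(r : ℤ)) r,
        invNorm (planePt d (c + a) (y + b) - sidePt d c y r (σ, ε, t)))
        (fun _ _ => Finset.sum_nonneg fun _ _ => invNorm_nonneg _) (Finset.mem_univ ε))
    rcases le_total |a| |b| with hle | hle
    · rw [max_eq_right hle] at hab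
      have hb' : b = if decide (0 ≤ b) then (r : ℤ) else -r := by
        by_cases h0 : 0 ≤ b
        · rw [abs_of_nonneg h0] at hab; simp [hab]
        · rw [abs_of_neg (not_le.1 h0)] at hab; simp [h0]; omega
      refine le_trans ?_ (key false (decide (0 ≤ b)))
      refine log_le_sum_Icc (by omega) ha (fun t => invNorm_nonneg _) fun t ht => ?_
      simp only [sidePt, planePt_sub, Bool.false_eq_true, if_false]
      rw [← hb']
      refine le_invNorm_planePt _ (sub_ne_zero.2 ht.symm) ?_
      push_cast; ring
    · rw [max_eq_left hle] at hab
      have ha' : a = if decide (0 ≤ a) then (r : ℤ) else -r := by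
        by_cases h0 : 0 ≤ a
        · rw [abs_of_nonneg h0] at hab; simp [hab]
        · rw [abs_of_neg (not_le.1 h0)] at hab; simp [h0]; omega
      refine le_trans ?_ (key true (decide (0 ≤ a)))
      refine log_le_sum_Icc (by omega) hb (fun t => invNorm_nonneg _) fun t ht => ?_
      simp only [sidePt, planePt_sub, if_true]
      rw [← ha']
      refine le_invNorm_planePt _ (sub_ne_zero.2 ht.symm) ?_
      push_cast; ring

lemma card_sideIdx (r : ℕ) : (sideIdx r).card = 4 * (2 * r + 1) := by
  simp only [sideIdx, Finset.card_product, Finset.card_univ, Fintype.card_bool, Int.card_Icc]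
  omega

/-- The constant governing the probability of hitting a ring. -/
noncomputable def ringC (r : ℕ) : ℝ := if r = 0 then 3 else 72 / Real.log r

lemma ringC_pos {r : ℕ} (hr : r = 0 ∨ 2 ≤ r) : 0 < ringC r := by
  unfold ringC
  split_ifs with h
  · norm_num
  · have : 0 < Real.log r := Real.log_pos (by have : 2 ≤ r := by omega
                                              exact_mod_cast this)
    positivity

lemma ringFn_le_of_far {d : ℕ} {c y : ℤ} {r : ℕ} (hr : r = 0 ∨ 2 ≤ r) {z : Zd d} {D : ℝ}
    (hD : 0 < D) (hrD : 2 * r ≤ D) (h : ∃ i, D ≤ |((z i - planePt d c y i : ℤ) : ℝ)|) :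
    ringFn d c y r z ≤ ringC r * ((max r 1 : ℕ) / D) := by
  obtain ⟨i, hi⟩ := h
  rcases hr with rfl | hr
  · have := invNorm_le (x := z - planePt d c y) hD (i := i) (by simpa using hi)
    simp only [ringFn, ringC, if_true]
    norm_num at this ⊢
    linarith
  · have hlog : 0 < Real.log r := Real.log_pos (by exact_mod_cast hr)
    have hr0 : r ≠ 0 := by omega
    simp only [ringFn, ringC, if_neg hr0, max_eq_left (show 1 ≤ r by omega)]
    have hp : potential (sideIdx r) (sidePt d c y r) z ≤ (sideIdx r).card / (D / 2) := by
      refine potential_le (by positivity) fun t ht => ⟨i, ?_⟩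
      have h1 : |sidePt d c y r t i - planePt d c y i| ≤ r := by
        have ht' : |t.2.2| ≤ r := by
          simp only [sideIdx, Finset.mem_product, Finset.mem_univ, true_and, Finset.mem_Icc] at ht
          exact abs_le.2 ht
        have h2 : ∀ ε : Bool, |if ε then (r : ℤ) else -r| ≤ r := by intro ε; cases ε <;> simp
        rw [← Pi.sub_apply]
        unfold sidePt
        split_ifs <;> rw [planePt_sub] <;> apply abs_planePt_le <;> simp [ht']
      have h1' : |((sidePt d c y r t i - planePt d c y i : ℤ) : ℝ)| ≤ r := by
        rw [← Int.cast_abs]; exact_mod_cast h1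
      have h3 : ((z i - planePt d c y i : ℤ) : ℝ) = ((z i - sidePt d c y r t i : ℤ) : ℝ) +
          ((sidePt d c y r t i - planePt d c y i : ℤ) : ℝ) := by push_cast; ring
      have h4 := abs_add_le ((z i - sidePt d c y r t i : ℤ) : ℝ)
          ((sidePt d c y r t i - planePt d c y i : ℤ) : ℝ)
      rw [← h3] at h4
      linarith
    have hr2 : (2 : ℝ) ≤ r := by exact_mod_cast hr
    calc 3 / Real.log r * potential (sideIdx r) (sidePt d c y r) z
        ≤ 3 / Real.log r * ((sideIdx r).card / (D / 2)) := by gcongr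
      _ = 24 * (2 * r + 1) / Real.log r / D := by
          rw [card_sideIdx]; push_cast; field_simp; norm_num
      _ ≤ 24 * (3 * r) / Real.log r / D := by gcongr; linarith
      _ = _ := by ring

lemma ringFn_le_of_near {d : ℕ} {c y : ℤ} {r : ℕ} (hr : 2 ≤ r) {z : Zd d} {D : ℕ}
    (hrD : 2 * D ≤ r) (hd : 3 ≤ d) (h : ∀ i, |z i - planePt d c y i| ≤ D) :
    ringFn d c y r z ≤ ringC r := by
  have hlog : 0 < Real.log r := Real.log_pos (by exact_mod_cast hr)
  have hr0 : r ≠ 0 := by omega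
  have hr2 : (2 : ℝ) ≤ r := by exact_mod_cast hr
  have hrD' : (2 * D : ℝ) ≤ r := by exact_mod_cast hrD
  simp only [ringFn, ringC, if_neg hr0]
  have hp : potential (sideIdx r) (sidePt d c y r) z ≤ (sideIdx r).card / (r / 2 : ℝ) := by
    refine potential_le (by positivity) fun t ht => ?_
    have hex : ∃ i, |sidePt d c y r t i - planePt d c y i| = r := by
      have h2 : ∀ ε : Bool, |if ε then (r : ℤ) else -r| = r := by intro ε; cases ε <;> simp
      simp_rw [← Pi.sub_apply]
      by_cases hs : t.1
      · refine ⟨⟨0, by omega⟩, ?_⟩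
        simp only [sidePt, hs, if_true, planePt_sub, planePt_zero hd, add_sub_cancel_left]
        exact h2 t.2.1
      · refine ⟨⟨1, by omega⟩, ?_⟩
        simp only [sidePt, hs, if_false, planePt_sub, planePt_one hd, add_sub_cancel_left,
          Bool.false_eq_true]
        exact h2 t.2.1
    obtain ⟨i, hi⟩ := hex
    refine ⟨i, ?_⟩
    have h1 := h i
    have h4 := abs_sub_abs_le_abs_sub (sidePt d c y r t i - planePt d c y i)
      (z i - planePt d c y i)
    rw [hi, show sidePt d c y r t i - planePt d c y i - (z i - planePt d c y i) =
      -(z i - sidePt d c y r t i) by ring, abs_neg] at h4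
    have h5 : (r : ℤ) - D ≤ |z i - sidePt d c y r t i| := by omega
    have h6 : (r : ℝ) - D ≤ |((z i - sidePt d c y r t i : ℤ) : ℝ)| := by
      rw [← Int.cast_abs]; exact_mod_cast h5
    linarith
  calc 3 / Real.log r * potential (sideIdx r) (sidePt d c y r) z
      ≤ 3 / Real.log r * ((sideIdx r).card / (r / 2 : ℝ)) := by gcongr
    _ = 24 * (2 * r + 1) / r / Real.log r := by
        rw [card_sideIdx]; push_cast; field_simp; norm_num
    _ ≤ 24 * (3 * r) / r / Real.log r := by gcongr; linarith
    _ = _ := by field_simp; norm_num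

/-- The indices `k` with `(i, k) ∈ R`. -/
def slice {ι κ : Type*} [Fintype κ] [DecidableEq ι] [DecidableEq κ] (R : Finset (ι × κ)) (i : ι) :
    Finset κ := Finset.univ.filter fun k => (i, k) ∈ R

/-- The second component of `a` if its first component is `i`. -/
def locAt {ι κ : Type*} [DecidableEq ι] (a : Option (ι × κ)) (i : ι) : Option κ :=
  a.bind fun b => if b.1 = i then some b.2 else none

lemma locAt_some_self {ι κ : Type*} [DecidableEq ι] (b : ι × κ) :
    locAt (some b) b.1 = some b.2 := by
  simp [locAt]

lemma locAt_some_of_ne {ι κ : Type*} [DecidableEq ι] {b : ι × κ} {i : ι} (h : b.1 ≠ i) :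
    locAt (some b) i = none := by
  simp [locAt, h]

/-- The weight of the set `S` of concentric rings (with centre indexed by `k₀`) that remain to be
visited from the ring `l` of the same family, or from a distant place. -/
noncomputable def weight {κ : Type*} [DecidableEq κ] (k₀ : κ) (ρ : κ → ℝ) (ρm s B : ℝ)
    (l : Option κ) (S : Finset κ) : ℝ :=
  match l with
  | none => if S = ∅ then 1 else if k₀ ∈ S then B / s else B * ρm / s
  | some k => if k₀ ∈ S then 1 / ρ k else 1

/-- A bound on the probability to go from the ring `l` of the same family (or a distant place)
to the ring `k`. -/
noncomputable def transBd {κ : Type*} (C ρ : κ → ℝ) (s : ℝ) (l : Option κ) (k : κ) : ℝ :=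
  match l with
  | none => C k * (ρ k / s)
  | some j => C k * min 1 (ρ k / ρ j)

/-- The contribution to `chainBd` of the rings with a given centre. -/
noncomputable def famBd {κ : Type*} [Fintype κ] [DecidableEq κ] (k₀ : κ) (C ρ : κ → ℝ)
    (ρm s B : ℝ) (l : Option κ) (S : Finset κ) : ℝ :=
  (∏ k ∈ S, (2 * Fintype.card κ * C k)) * weight k₀ ρ ρm s B l S

/-- A bound on the probability to visit all the rings of `R`. -/
noncomputable def chainBd {ι κ : Type*} [Fintype ι] [Fintype κ] [DecidableEq ι] [DecidableEq κ]
    (k₀ : κ) (C ρ : κ → ℝ) (ρm s B : ℝ) (a : Option (ι × κ)) (R : Finset (ι × κ)) : ℝ :=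
  ∏ i, famBd k₀ C ρ ρm s B (locAt a i) (slice R i)

lemma weight_nonneg {κ : Type*} [DecidableEq κ] {k₀ : κ} {ρ : κ → ℝ} {ρm s B : ℝ}
    (hρ : ∀ k, 0 < ρ k) (hρm : 0 ≤ ρm) (hs : 0 < s) (hB : 0 ≤ B)
    (l : Option κ) (S : Finset κ) : 0 ≤ weight k₀ ρ ρm s B l S := by
  cases l with
  | none => simp only [weight]; split_ifs <;> positivity
  | some k =>
    have := hρ k
    simp only [weight]; split_ifs <;> positivity

lemma weight_none_le {κ : Type*} [DecidableEq κ] {k₀ : κ} {ρ : κ → ℝ} {ρm s B : ℝ}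
    (hρ : ∀ k, 0 < ρ k) (hρm : ∀ k, ρ k ≤ ρm) (hs : 0 < s) (hB : 0 ≤ B) (hBs : B * ρm ≤ s)
    (l : Option κ) (S : Finset κ) : weight k₀ ρ ρm s B none S ≤ weight k₀ ρ ρm s B l S := by
  cases l with
  | none => exact le_rfl
  | some k =>
    have := hρ k
    simp only [weight]
    split_ifs with h1 h2 h2
    · simp [h1] at h2
    · exact le_rfl
    · rw [div_le_div_iff₀ hs this, one_mul]
      exact (mul_le_mul_of_nonneg_left (hρm k) hB).trans hBs
    · exact div_le_one_of_le₀ hBs hs.le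

lemma min_mul_weight_le {κ : Type*} [DecidableEq κ] {k₀ : κ} {ρ : κ → ℝ} {ρm s B : ℝ}
    (hρ : ∀ k, 0 < ρ k) (hρ0 : ρ k₀ = 1) {S : Finset κ} {k : κ} (hk : k ∈ S) (j : κ) :
    min 1 (ρ k / ρ j) * weight k₀ ρ ρm s B (some k) (S.erase k) ≤
      weight k₀ ρ ρm s B (some j) S := by
  have hk0 := hρ k
  have hj0 := hρ j
  simp only [weight]
  by_cases hkk : k = k₀
  · subst hkk
    simp [hk, hρ0]
  · have : k₀ ∈ S.erase k ↔ k₀ ∈ S := by simp [Finset.mem_erase, Ne.symm hkk]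
    simp only [this]
    split_ifs
    · calc min 1 (ρ k / ρ j) * (1 / ρ k) ≤ ρ k / ρ j * (1 / ρ k) := by
            gcongr; exact min_le_right _ _
        _ = _ := by field_simp
    · simp

lemma div_mul_weight_le {κ : Type*} [DecidableEq κ] {k₀ : κ} {ρ : κ → ℝ} {ρm s B : ℝ}
    (hρ : ∀ k, 0 < ρ k) (hρ0 : ρ k₀ = 1) (hρm : ∀ k, ρ k ≤ ρm) (hs : 0 < s) (hB : 0 < B)
    {S : Finset κ} {k : κ} (hk : k ∈ S) :
    ρ k / s * weight k₀ ρ ρm s B (some k) (S.erase k) ≤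
      weight k₀ ρ ρm s B none S / B := by
  have hk0 := hρ k
  have hne : S ≠ ∅ := Finset.ne_empty_of_mem hk
  simp only [weight, if_neg hne]
  by_cases hkk : k = k₀
  · subst hkk
    simp [hk, hρ0]
    field_simp
    exact le_rfl
  · have : k₀ ∈ S.erase k ↔ k₀ ∈ S := by simp [Finset.mem_erase, Ne.symm hkk]
    simp only [this]
    split_ifs
    · field_simp; exact le_rfl
    · have := hρm k
      calc ρ k / s * 1 ≤ ρm / s * 1 := by gcongr
        _ = _ := by field_simp

lemma slice_erase_self {ι κ : Type*} [Fintype κ] [DecidableEq ι] [DecidableEq κ]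
    (R : Finset (ι × κ)) (b : ι × κ) : slice (R.erase b) b.1 = (slice R b.1).erase b.2 := by
  ext k
  simp [slice, Prod.ext_iff]

lemma slice_erase_of_ne {ι κ : Type*} [Fintype κ] [DecidableEq ι] [DecidableEq κ]
    (R : Finset (ι × κ)) {b : ι × κ} {i : ι} (h : b.1 ≠ i) : slice (R.erase b) i = slice R i := by
  ext k
  simp [slice, Prod.ext_iff, Ne.symm h]

lemma famBd_nonneg {κ : Type*} [Fintype κ] [DecidableEq κ] {k₀ : κ} {C ρ : κ → ℝ} {ρm s B : ℝ}
    (hC : ∀ k, 0 ≤ C k) (hρ : ∀ k, 0 < ρ k) (hρm : 0 ≤ ρm) (hs : 0 < s) (hB : 0 ≤ B)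
    (l : Option κ) (S : Finset κ) : 0 ≤ famBd k₀ C ρ ρm s B l S :=
  mul_nonneg (Finset.prod_nonneg fun k _ => by have := hC k; positivity)
    (weight_nonneg hρ hρm hs hB l S)

lemma chainBd_nonneg {ι κ : Type*} [Fintype ι] [Fintype κ] [DecidableEq ι] [DecidableEq κ]
    {k₀ : κ} {C ρ : κ → ℝ} {ρm s B : ℝ}
    (hC : ∀ k, 0 ≤ C k) (hρ : ∀ k, 0 < ρ k) (hρm : 0 ≤ ρm) (hs : 0 < s) (hB : 0 ≤ B)
    (a : Option (ι × κ)) (R : Finset (ι × κ)) : 0 ≤ chainBd k₀ C ρ ρm s B a R :=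
  Finset.prod_nonneg fun _ _ => famBd_nonneg hC hρ hρm hs hB _ _

/-- The share of a transition in `chainBd`. -/
noncomputable def stepShare {κ : Type*} [Fintype κ] (B : ℝ) (l : Option κ) : ℝ :=
  if l = none then (2 * Fintype.card κ * B)⁻¹ else (2 * Fintype.card κ : ℝ)⁻¹

lemma transBd_mul_famBd_le {κ : Type*} [Fintype κ] [DecidableEq κ] {k₀ : κ} {C ρ : κ → ℝ}
    {ρm s B : ℝ} (hC : ∀ k, 0 ≤ C k) (hρ : ∀ k, 0 < ρ k) (hρ0 : ρ k₀ = 1) (hρm : ∀ k, ρ k ≤ ρm)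
    (hs : 0 < s) (hB : 0 < B) {S : Finset κ} {k : κ} (hk : k ∈ S) (l : Option κ) :
    transBd C ρ s l k * famBd k₀ C ρ ρm s B (some k) (S.erase k) ≤
      stepShare B l * famBd k₀ C ρ ρm s B l S := by
  have hcard : (0 : ℝ) < Fintype.card κ := by
    exact_mod_cast Fintype.card_pos_iff.2 ⟨k⟩
  unfold famBd
  rw [← Finset.mul_prod_erase S _ hk]
  set T := ∏ k ∈ S.erase k, (2 * Fintype.card κ * C k) with hT
  have hT0 : 0 ≤ T := Finset.prod_nonneg fun k _ => by have := hC k; positivity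
  have hCk := hC k
  cases l with
  | none =>
    have h := div_mul_weight_le (k₀ := k₀) hρ hρ0 hρm hs hB hk
    simp only [transBd, stepShare, if_true]
    calc _ = C k * T * (ρ k / s * weight k₀ ρ ρm s B (some k) (S.erase k)) := by ring
      _ ≤ C k * T * (weight k₀ ρ ρm s B none S / B) := by gcongr
      _ = _ := by field_simp
  | some j =>
    have h := min_mul_weight_le (k₀ := k₀) (ρm := ρm) (s := s) (B := B) hρ hρ0 hk j
    simp only [transBd, stepShare, reduceCtorEq, if_false]
    calc _ = C k * T * (min 1 (ρ k / ρ j) * weight k₀ ρ ρm s B (some k) (S.erase k)) := by ring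
      _ ≤ C k * T * (weight k₀ ρ ρm s B (some j) S) := by gcongr
      _ = _ := by field_simp

lemma transBd_nonneg {κ : Type*} {C ρ : κ → ℝ} {s : ℝ} (hC : ∀ k, 0 ≤ C k)
    (hρ : ∀ k, 0 < ρ k) (hs : 0 < s) (l : Option κ) (k : κ) : 0 ≤ transBd C ρ s l k := by
  have h1 := hC k
  have h2 := hρ k
  cases l with
  | none => simp only [transBd]; positivity
  | some j =>
    have h3 := hρ j
    simp only [transBd]; positivity

lemma transBd_mul_chainBd_le {ι κ : Type*} [Fintype ι] [Fintype κ] [DecidableEq ι]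
    [DecidableEq κ] {k₀ : κ} {C ρ : κ → ℝ}
    {ρm s B : ℝ} (hC : ∀ k, 0 ≤ C k) (hρ : ∀ k, 0 < ρ k) (hρ0 : ρ k₀ = 1) (hρm : ∀ k, ρ k ≤ ρm)
    (hs : 0 < s) (hB : 0 < B) (hBs : B * ρm ≤ s) {R : Finset (ι × κ)} {b : ι × κ} (hb : b ∈ R)
    (a : Option (ι × κ)) :
    transBd C ρ s (locAt a b.1) b.2 * chainBd k₀ C ρ ρm s B (some b) (R.erase b) ≤
      stepShare B (locAt a b.1) * chainBd k₀ C ρ ρm s B a R := by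
  have hρm0 : 0 ≤ ρm := (hρ k₀).le.trans (hρm k₀)
  unfold chainBd
  rw [← Finset.mul_prod_erase Finset.univ _ (Finset.mem_univ b.1),
    ← Finset.mul_prod_erase Finset.univ (fun i => famBd k₀ C ρ ρm s B (locAt a i) (slice R i))
      (Finset.mem_univ b.1), ← mul_assoc, ← mul_assoc, locAt_some_self, slice_erase_self]
  have hbs : b.2 ∈ slice R b.1 := by simpa [slice] using hb
  have h1 := transBd_mul_famBd_le hC hρ hρ0 hρm hs hB hbs (locAt a b.1)
  refine mul_le_mul h1 ?_ (Finset.prod_nonneg fun _ _ => famBd_nonneg hC hρ hρm0 hs hB.le _ _)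
    ((mul_nonneg (transBd_nonneg hC hρ hs _ _) (famBd_nonneg hC hρ hρm0 hs hB.le _ _)).trans h1)
  refine Finset.prod_le_prod (fun _ _ => famBd_nonneg hC hρ hρm0 hs hB.le _ _) fun i hi => ?_
  have hne : b.1 ≠ i := (Finset.ne_of_mem_erase hi).symm
  rw [locAt_some_of_ne hne, slice_erase_of_ne R hne]
  exact mul_le_mul_of_nonneg_left (weight_none_le hρ hρm hs hB.le hBs _ _)
    (Finset.prod_nonneg fun k _ => by have := hC k; positivity)

lemma sum_stepShare_le {ι κ : Type*} [Fintype ι] [Fintype κ] [DecidableEq ι] [Nonempty κ]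
    [Nonempty ι] (a : Option (ι × κ)) (R : Finset (ι × κ)) :
    ∑ b ∈ R, stepShare (Fintype.card ι) (locAt a b.1) ≤ 1 := by
  classical
  have hcκ : (0 : ℝ) < Fintype.card κ := by exact_mod_cast Fintype.card_pos
  have hcι : (0 : ℝ) < Fintype.card ι := by exact_mod_cast Fintype.card_pos
  have h0 : ∀ l : Option κ, 0 ≤ stepShare (Fintype.card ι) l := fun l => by
    unfold stepShare; split_ifs <;> positivity
  have h1 : ∀ i : ι, stepShare (Fintype.card ι) (locAt a i) ≤
      (2 * Fintype.card κ * Fintype.card ι : ℝ)⁻¹ +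
        if a.map Prod.fst = some i then (2 * Fintype.card κ : ℝ)⁻¹ else 0 := fun i => by
    cases a with
    | none => simp [stepShare, locAt]
    | some b =>
      by_cases hb : b.1 = i
      · simp [stepShare, locAt, hb]
        positivity
      · simp [stepShare, locAt, hb]
  calc ∑ b ∈ R, stepShare (Fintype.card ι) (locAt a b.1)
      ≤ ∑ b : ι × κ, stepShare (Fintype.card ι) (locAt a b.1) :=
        Finset.sum_le_sum_of_subset_of_nonneg (Finset.subset_univ _) fun _ _ _ => h0 _
    _ = ∑ i : ι, Fintype.card κ * stepShare (Fintype.card ι) (locAt a i) := by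
        rw [Fintype.sum_prod_type]; simp
    _ ≤ ∑ i : ι, Fintype.card κ * ((2 * Fintype.card κ * Fintype.card ι : ℝ)⁻¹ +
        if a.map Prod.fst = some i then (2 * Fintype.card κ : ℝ)⁻¹ else 0) := by
        gcongr with i; exact h1 i
    _ = 2⁻¹ + Fintype.card κ * ∑ i : ι,
        if a.map Prod.fst = some i then (2 * Fintype.card κ : ℝ)⁻¹ else 0 := by
        rw [← Finset.mul_sum, Finset.sum_add_distrib, mul_add]
        simp only [Finset.sum_const, Finset.card_univ, nsmul_eq_mul]
        congr 1
        field_simp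
    _ ≤ 2⁻¹ + Fintype.card κ * (2 * Fintype.card κ : ℝ)⁻¹ := by
        gcongr
        cases a with
        | none => simp
        | some b => simp
    _ = 1 := by field_simp; norm_num

/-- The probability of visiting all the sets of the family `R` is at most `chainBd`. -/
lemma real_hitAll_le_chainBd {d : ℕ} (hd : 0 < d) {P : Zd d → Measure (ℕ → Zd d)}
    (hP : IsSRW d P) {ι κ : Type*} [Fintype ι] [Fintype κ] [DecidableEq ι]
    [DecidableEq κ] {k₀ : κ} {C ρ : κ → ℝ}
    {ρm s : ℝ} (hC : ∀ k, 0 ≤ C k) (hρ : ∀ k, 0 < ρ k) (hρ0 : ρ k₀ = 1) (hρm : ∀ k, ρ k ≤ ρm)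
    (hs : 0 < s) (hBs : Fintype.card ι * ρm ≤ s) (G : ι × κ → Set (Zd d))
    {ψ : ι × κ → Zd d → ℝ} (hψ0 : ∀ b x, 0 ≤ ψ b x)
    (hψ : ∀ b x, avg (ψ b) x ≤ ψ b x) (hψG : ∀ b, ∀ x ∈ G b, 1 ≤ ψ b x)
    (htrans : ∀ a b, a ≠ b → ∀ x ∈ G a, ψ b x ≤ transBd C ρ s (locAt (some a) b.1) b.2)
    (R : Finset (ι × κ)) (a : Option (ι × κ)) (z : Zd d)
    (hz : ∀ b ∈ R, ψ b z ≤ transBd C ρ s (locAt a b.1) b.2) :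
    (P z).real (hitAll G R) ≤ chainBd k₀ C ρ ρm s (Fintype.card ι) a R := by
  have := hP.1
  have hρm0 : 0 ≤ ρm := (hρ k₀).le.trans (hρm k₀)
  induction hn : R.card generalizing R a z with
  | zero =>
    rw [Finset.card_eq_zero.1 hn]
    have : chainBd k₀ C ρ ρm s (Fintype.card ι) a (∅ : Finset (ι × κ)) = 1 := by
      refine Finset.prod_eq_one fun i _ => ?_
      have : slice (∅ : Finset (ι × κ)) i = ∅ := by simp [slice]
      rw [this]
      cases locAt a i <;> simp [famBd, weight]
    rw [this]
    exact measureReal_le_one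
  | succ n ih =>
    have hne : R.Nonempty := Finset.card_pos.1 (by omega)
    obtain ⟨b₀, -⟩ := hne
    have : Nonempty ι := ⟨b₀.1⟩
    have : Nonempty κ := ⟨b₀.2⟩
    have hB : (0 : ℝ) < Fintype.card ι := by exact_mod_cast Fintype.card_pos
    have hne : R.Nonempty := Finset.card_pos.1 (by omega)
    have hU : ∀ a R, 0 ≤ chainBd k₀ C ρ ρm s (Fintype.card ι : ℝ) (a : Option (ι × κ)) R :=
      fun a R => chainBd_nonneg hC hρ hρm0 hs hB.le a R
    refine (real_hitAll_le_sum hd hP G hne hψ0 hψ hψG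
      (M := fun b => chainBd k₀ C ρ ρm s (Fintype.card ι) (some b) (R.erase b))
      (fun b _ => hU _ _) (fun b hb x hx => ?_) z).trans ?_
    · refine ih (R.erase b) (some b) x (fun b' hb' => ?_) ?_
      · exact htrans b b' (Finset.ne_of_mem_erase hb').symm x hx
      · rw [Finset.card_erase_of_mem hb, hn]; rfl
    · calc ∑ b ∈ R, ψ b z * chainBd k₀ C ρ ρm s (Fintype.card ι) (some b) (R.erase b)
          ≤ ∑ b ∈ R, stepShare (Fintype.card ι) (locAt a b.1) *
              chainBd k₀ C ρ ρm s (Fintype.card ι) a R := Finset.sum_le_sum fun b hb =>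
            (mul_le_mul_of_nonneg_right (hz b hb) (hU _ _)).trans
              (transBd_mul_chainBd_le hC hρ hρ0 hρm hs hB hBs hb a)
        _ = (∑ b ∈ R, stepShare (Fintype.card ι) (locAt a b.1)) *
              chainBd k₀ C ρ ρm s (Fintype.card ι) a R := by rw [Finset.sum_mul]
        _ ≤ 1 * chainBd k₀ C ρ ρm s (Fintype.card ι) a R := by
            gcongr
            · exact hU _ _
            · exact sum_stepShare_le a R
        _ = _ := one_mul _

/-- Families of concentric rings whose centres are spaced along the strip. -/
structure RingSystem (L p J : ℕ) where
  gap : ℕ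
  rad : Fin (J + 1) → ℕ
  maxRad : ℕ
  rad_zero : rad 0 = 0
  two_le_rad : ∀ k, k ≠ 0 → 2 ≤ rad k
  two_mul_rad_le : ∀ j k, j < k → 2 * max (rad j) 1 ≤ rad k
  rad_le : ∀ k, max (rad k) 1 ≤ maxRad
  four_mul_le : 4 * maxRad ≤ gap
  mul_maxRad_le : 2 * p * maxRad ≤ gap
  mul_gap_lt : p * gap < 2 * L

namespace RingSystem

/-- The abscissa of the centre of the `i`-th family. -/
def abscissa {L p J : ℕ} (S : RingSystem L p J) (i : Fin p) : ℤ := (i + 1) * S.gap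

/-- The `k`-th ring of the `i`-th family, with centres of ordinates `y`. -/
def ring {L p J : ℕ} (S : RingSystem L p J) (d : ℕ) (y : Fin p → ℤ) (b : Fin p × Fin (J + 1)) :
    Set (Zd d) := sqRing d (S.abscissa b.1) (y b.1) (S.rad b.2)

/-- The constant of the `k`-th ring. -/
noncomputable def const {L p J : ℕ} (S : RingSystem L p J) (k : Fin (J + 1)) : ℝ :=
  ringC (S.rad k)

/-- The size of the `k`-th ring. -/
def size {L p J : ℕ} (S : RingSystem L p J) (k : Fin (J + 1)) : ℕ := max (S.rad k) 1

lemma rad_eq_or {L p J : ℕ} (S : RingSystem L p J) (k : Fin (J + 1)) :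
    S.rad k = 0 ∨ 2 ≤ S.rad k := by
  by_cases hk : k = 0
  · left; rw [hk, S.rad_zero]
  · right; exact S.two_le_rad k hk

lemma const_pos {L p J : ℕ} (S : RingSystem L p J) (k : Fin (J + 1)) : 0 < S.const k :=
  ringC_pos (S.rad_eq_or k)

lemma size_zero {L p J : ℕ} (S : RingSystem L p J) : S.size 0 = 1 := by
  simp [size, S.rad_zero]

lemma size_pos {L p J : ℕ} (S : RingSystem L p J) (k : Fin (J + 1)) : 0 < S.size k := by
  simp [size]

lemma gap_pos {L p J : ℕ} (S : RingSystem L p J) : 0 < S.gap := by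
  have h1 := S.rad_le 0
  have h2 := S.four_mul_le
  have h3 := le_max_right (S.rad 0) 1
  omega

lemma abscissa_pos {L p J : ℕ} (S : RingSystem L p J) (i : Fin p) : 0 < S.abscissa i := by
  have := S.gap_pos
  unfold abscissa
  positivity

lemma abscissa_lt {L p J : ℕ} (S : RingSystem L p J) (i : Fin p) : S.abscissa i < 2 * L := by
  have h1 := S.mul_gap_lt
  have h2 : ((i : ℕ) + 1) * S.gap ≤ p * S.gap := Nat.mul_le_mul_right _ i.2
  unfold abscissa
  exact_mod_cast h2.trans_lt h1

lemma gap_le_abs_abscissa_sub {L p J : ℕ} (S : RingSystem L p J) {i j : Fin p} (h : i ≠ j) :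
    (S.gap : ℤ) ≤ |S.abscissa i - S.abscissa j| := by
  have h1 : S.abscissa i - S.abscissa j = ((i : ℤ) - j) * S.gap := by unfold abscissa; ring
  have h2 : 1 ≤ |(i : ℤ) - j| := Int.one_le_abs (sub_ne_zero.2 (by
    intro hij; exact h (Fin.ext (by exact_mod_cast hij))))
  rw [h1, abs_mul, abs_of_nonneg (show (0 : ℤ) ≤ S.gap by positivity)]
  nlinarith [S.gap_pos]

lemma ringFn_le_transBd_of_far {L p J : ℕ} (S : RingSystem L p J) {d : ℕ} {c y : ℤ}
    (k : Fin (J + 1)) {z : Zd d} (h : ∃ i, (S.gap : ℤ) ≤ 2 * |z i - planePt d c y i|) :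
    ringFn d c y (S.rad k) z ≤
      transBd S.const (fun k => (S.size k : ℝ)) (S.gap / 2 : ℝ) none k := by
  obtain ⟨i, hi⟩ := h
  have hg : (0 : ℝ) < S.gap := by exact_mod_cast S.gap_pos
  refine ringFn_le_of_far (S.rad_eq_or k) (by positivity) ?_ ⟨i, ?_⟩
  · have h1 := S.four_mul_le
    have h2 := (le_max_left _ _).trans (S.rad_le k)
    have h3 : (4 * S.rad k : ℝ) ≤ S.gap := by exact_mod_cast (by omega : 4 * S.rad k ≤ S.gap)
    linarith
  · rw [← Int.cast_abs]
    have : (S.gap : ℝ) ≤ 2 * (|z i - planePt d c y i| : ℤ) := by exact_mod_cast hi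
    linarith

lemma ringFn_le_transBd {L p J : ℕ} (S : RingSystem L p J) {d : ℕ} (hd : 3 ≤ d) {y : Fin p → ℤ}
    {a b : Fin p × Fin (J + 1)} (hab : a ≠ b) {x : Zd d} (hx : x ∈ S.ring d y a) :
    ringFn d (S.abscissa b.1) (y b.1) (S.rad b.2) x ≤
      transBd S.const (fun k => (S.size k : ℝ)) (S.gap / 2 : ℝ) (locAt (some a) b.1) b.2 := by
  obtain ⟨u, v, rfl, huv⟩ := hx
  have hu : |u| ≤ S.rad a.2 := huv ▸ le_max_left _ _
  have hv : |v| ≤ S.rad a.2 := huv ▸ le_max_right _ _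
  by_cases h1 : a.1 = b.1
  · rw [← h1, locAt_some_self]
    have hne : a.2 ≠ b.2 := fun h => hab (Prod.ext h1 h)
    have hsa : (0 : ℝ) < S.size a.2 := by exact_mod_cast S.size_pos a.2
    simp only [transBd]
    rcases lt_or_gt_of_ne hne with hlt | hlt
    · have h2 := S.two_mul_rad_le _ _ hlt
      have hb0 : b.2 ≠ 0 := by
        intro h; rw [h] at hlt; exact absurd hlt (Fin.not_lt_zero _)
      have hsize : S.size a.2 ≤ S.size b.2 := by unfold size; omega
      rw [min_eq_left ((one_le_div hsa).2 (by exact_mod_cast hsize)), mul_one]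
      refine ringFn_le_of_near (S.two_le_rad _ hb0) (D := S.rad a.2) (by omega) hd fun i => ?_
      rw [← Pi.sub_apply, planePt_sub]
      exact abs_planePt_le (by simpa using hu) (by simpa using hv) i
    · have h2 := S.two_mul_rad_le _ _ hlt
      have hra : S.size a.2 = S.rad a.2 := by unfold size; omega
      have hsize : S.size b.2 ≤ S.size a.2 := by rw [hra]; unfold size; omega
      rw [min_eq_right ((div_le_one hsa).2 (by exact_mod_cast hsize))]
      refine ringFn_le_of_far (S.rad_eq_or _) hsa ?_ ?_
      · rw [hra]; exact_mod_cast (by omega : 2 * S.rad b.2 ≤ S.rad a.2)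
      · rw [hra]
        simp_rw [← Pi.sub_apply, planePt_sub]
        rcases max_choice |u| |v| with h | h
        · refine ⟨⟨0, by omega⟩, ?_⟩
          rw [planePt_zero hd, add_sub_cancel_left, ← Int.cast_abs]
          exact_mod_cast (by omega : (S.rad a.2 : ℤ) ≤ |u|)
        · refine ⟨⟨1, by omega⟩, ?_⟩
          rw [planePt_one hd, add_sub_cancel_left, ← Int.cast_abs]
          exact_mod_cast (by omega : (S.rad a.2 : ℤ) ≤ |v|)
  · rw [locAt_some_of_ne h1]
    refine S.ringFn_le_transBd_of_far b.2 ⟨⟨0, by omega⟩, ?_⟩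
    rw [planePt_zero hd, planePt_zero hd]
    have h2 := S.gap_le_abs_abscissa_sub h1
    have h3 := (le_max_left _ _).trans (S.rad_le a.2)
    have h4 := S.four_mul_le
    have h5 := abs_add_le (S.abscissa a.1 + u - S.abscissa b.1) (-u)
    rw [show S.abscissa a.1 + u - S.abscissa b.1 + -u = S.abscissa a.1 - S.abscissa b.1 by ring,
      abs_neg] at h5
    omega

/-- The bound on the probability to visit the rings with indices in `T` of one family. -/
noncomputable def famProb {L p J : ℕ} (S : RingSystem L p J) (T : Finset (Fin (J + 1))) : ℝ :=
  famBd 0 S.const (fun k => (S.size k : ℝ)) S.maxRad (S.gap / 2) p none T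

lemma famProb_nonneg {L p J : ℕ} (S : RingSystem L p J) (T : Finset (Fin (J + 1))) :
    0 ≤ S.famProb T :=
  famBd_nonneg (fun k => (S.const_pos k).le) (fun k => by exact_mod_cast S.size_pos k)
    (by positivity) (by have := S.gap_pos; positivity) (by positivity) _ _

lemma famProb_empty {L p J : ℕ} (S : RingSystem L p J) : S.famProb ∅ = 1 := by
  simp [famProb, famBd, weight]

lemma real_hitAll_ring_le {L p J : ℕ} (S : RingSystem L p J) {d : ℕ} (hd : 3 ≤ d)
    {P : Zd d → Measure (ℕ → Zd d)} (hP : IsSRW d P) {y : Fin p → ℤ}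
    (hy : ∀ i, 0 ≤ y i ∧ y i ≤ 6 * L) (R : Finset (Fin p × Fin (J + 1))) {z : Zd d}
    (hz : ∃ i, (7 * L : ℤ) ≤ |z i|) :
    (P z).real (hitAll (S.ring d y) R) ≤ ∏ i, S.famProb (slice R i) := by
  have hg := S.gap_pos
  have h2 : (2 * p * S.maxRad : ℝ) ≤ S.gap := by exact_mod_cast S.mul_maxRad_le
  have key := real_hitAll_le_chainBd (by omega) hP (k₀ := (0 : Fin (J + 1))) (C := S.const)
    (ρ := fun k => (S.size k : ℝ)) (ρm := S.maxRad) (s := S.gap / 2) (ι := Fin p)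
    (fun k => (S.const_pos k).le) (fun k => by exact_mod_cast S.size_pos k)
    (by simp [S.size_zero]) (fun k => by exact_mod_cast S.rad_le k) (by positivity)
    (by rw [Fintype.card_fin]; linarith) (S.ring d y)
    (ψ := fun b => ringFn d (S.abscissa b.1) (y b.1) (S.rad b.2))
    (fun b x => ringFn_nonneg _ _ _ _ _) (fun b x => avg_ringFn_le hd _ _ _ _)
    (fun b x hx => one_le_ringFn _ _ (S.rad_eq_or _) hx)
    (fun a b hab x hx => S.ringFn_le_transBd hd hab hx) R none z ?_
  · simpa [chainBd, famProb, locAt] using key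
  · intro b hb
    refine S.ringFn_le_transBd_of_far b.2 ?_
    obtain ⟨i, hi⟩ := hz
    refine ⟨i, ?_⟩
    have h3 : |planePt d (S.abscissa b.1) (y b.1) i| ≤ 6 * L := by
      have h4 := S.abscissa_pos b.1
      have h5 := S.abscissa_lt b.1
      have h6 := hy b.1
      exact abs_planePt_le (by rw [abs_of_nonneg h4.le]; omega)
        (by rw [abs_of_nonneg h6.1]; exact h6.2) i
    have h7 := abs_sub_abs_le_abs_sub (z i) (planePt d (S.abscissa b.1) (y b.1) i)
    have h8 : S.gap ≤ 2 * L := by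
      have := S.mul_gap_lt
      have hp : 1 ≤ p := Nat.one_le_of_lt b.1.2
      nlinarith
    omega

end RingSystem

/-- The law of the walks started from the equilibrium measure of `K`. -/
noncomputable def eqmLaw {d : ℕ} (P : Zd d → Measure (ℕ → Zd d)) (K : Finset (Zd d)) :
    Measure (ℕ → Zd d) := ∑ x ∈ K, ENNReal.ofReal (eqm P K x) • P x

lemma eqmLaw_apply {d : ℕ} {P : Zd d → Measure (ℕ → Zd d)} (hP : IsSRW d P) (K : Finset (Zd d))
    (E : Set (ℕ → Zd d)) :
    eqmLaw P K E = ENNReal.ofReal (∑ x ∈ K, eqm P K x * (P x).real E) := by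
  have := hP.1
  rw [ENNReal.ofReal_sum_of_nonneg fun x _ => mul_nonneg (eqm_nonneg _ _ _) measureReal_nonneg]
  simp only [eqmLaw, Measure.coe_finsetSum, Finset.sum_apply, Measure.smul_apply, smul_eq_mul]
  refine Finset.sum_congr rfl fun x _ => ?_
  rw [ENNReal.ofReal_mul (eqm_nonneg _ _ _), ofReal_measureReal]

lemma isFiniteMeasure_eqmLaw {d : ℕ} {P : Zd d → Measure (ℕ → Zd d)} (hP : IsSRW d P)
    (K : Finset (Zd d)) : IsFiniteMeasure (eqmLaw P K) :=
  ⟨by rw [eqmLaw_apply hP]; exact ENNReal.ofReal_lt_top⟩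

lemma eqmLaw_univ {d : ℕ} {P : Zd d → Measure (ℕ → Zd d)} (hP : IsSRW d P) (K : Finset (Zd d)) :
    eqmLaw P K Set.univ = ENNReal.ofReal (capa P K) := by
  have := hP.1
  rw [eqmLaw_apply hP]
  simp [capa]

lemma capa_nonneg {d : ℕ} (P : Zd d → Measure (ℕ → Zd d)) (K : Finset (Zd d)) : 0 ≤ capa P K :=
  Finset.sum_nonneg fun _ _ => eqm_nonneg _ _ _

lemma eqmLaw_avoid {d : ℕ} (hd : 0 < d) {P : Zd d → Measure (ℕ → Zd d)} (hP : IsSRW d P)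
    {S K : Finset (Zd d)} (hSK : S ⊆ K) :
    eqmLaw P K (hitIn ↑S Set.univ)ᶜ = ENNReal.ofReal (capa P K - capa P S) := by
  have := isFiniteMeasure_eqmLaw hP K
  rw [measure_compl (measurableSet_hitIn _ _) (measure_ne_top _ _), eqmLaw_univ hP,
    ENNReal.ofReal_sub _ (capa_nonneg P S)]
  congr 1
  rw [eqmLaw_apply hP, capa_eq_sum_eqm_mul_hitProb hd hP hSK]
  rfl

lemma eqmLaw_avoid_nonneg {d : ℕ} (hd : 0 < d) {P : Zd d → Measure (ℕ → Zd d)} (hP : IsSRW d P)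
    {S K : Finset (Zd d)} (hSK : S ⊆ K) : 0 ≤ capa P K - capa P S := by
  rw [capa_eq_sum_eqm_mul_hitProb hd hP hSK, capa, ← Finset.sum_sub_distrib]
  refine Finset.sum_nonneg fun x _ => ?_
  have := mul_le_mul_of_nonneg_left (hitProb_le_one hP (↑S) Set.univ x) (eqm_nonneg P K x)
  linarith

lemma eq_of_sum_powerset_eq {α : Type*} [DecidableEq α] {K : Finset α} {f g : Finset α → ENNReal}
    (hf : ∀ B, f B ≠ ⊤) (h : ∀ A ⊆ K, ∑ B ∈ A.powerset, f B = ∑ B ∈ A.powerset, g B) :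
    ∀ A ⊆ K, f A = g A := by
  intro A
  induction A using Finset.strongInduction with
  | H A ih =>
    intro hA
    have h1 := h A hA
    rw [← Finset.add_sum_erase _ _ (Finset.mem_powerset_self A),
      ← Finset.add_sum_erase _ g (Finset.mem_powerset_self A)] at h1
    have h2 : ∑ B ∈ A.powerset.erase A, f B = ∑ B ∈ A.powerset.erase A, g B := by
      refine Finset.sum_congr rfl fun B hB => ?_
      have hBA := Finset.mem_powerset.1 (Finset.mem_of_mem_erase hB)
      exact ih B (hBA.ssubset_of_ne (Finset.ne_of_mem_erase hB)) (hBA.trans hA)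
    rw [← h2] at h1
    exact (ENNReal.add_left_inj (ENNReal.sum_ne_top.2 fun B _ => hf B)).1 h1

lemma measurableSet_finset_pred {α Ω : Type*} [MeasurableSpace Ω] {K : Finset α}
    {X : Ω → Finset α} (hXK : ∀ ω, X ω ⊆ K) (hX : ∀ x, MeasurableSet {ω | x ∈ X ω})
    (p : Finset α → Prop) : MeasurableSet {ω | p (X ω)} := by
  classical
  have : {ω | p (X ω)} = ⋃ B ∈ K.powerset.filter p, ⋂ x ∈ K, {ω | x ∈ X ω ↔ x ∈ B} := by
    ext ω
    simp only [Set.mem_ofPred_eq, Set.mem_iUnion, Set.mem_iInter, exists_prop, Finset.mem_filter,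
      Finset.mem_powerset]
    constructor
    · intro h
      exact ⟨X ω, ⟨hXK ω, h⟩, fun _ _ => Iff.rfl⟩
    · rintro ⟨B, ⟨hB, hp⟩, h⟩
      have : X ω = B := by
        ext x
        by_cases hx : x ∈ K
        · exact h x hx
        · exact iff_of_false (fun h => hx (hXK ω h)) fun h => hx (hB h)
      rwa [this]
  rw [this]
  refine Finset.measurableSet_biUnion _ fun B _ => Finset.measurableSet_biInter _ fun x _ => ?_
  by_cases hx : x ∈ B
  · have : {ω | x ∈ X ω ↔ x ∈ B} = {ω | x ∈ X ω} := by ext ω; simp [hx]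
    rw [this]
    exact hX x
  · have : {ω | x ∈ X ω ↔ x ∈ B} = {ω | x ∈ X ω}ᶜ := by ext ω; simp [hx]
    rw [this]
    exact (hX x).compl

lemma measure_finset_pred {α Ω : Type*} [DecidableEq α] [MeasurableSpace Ω] (μ : Measure Ω)
    {K : Finset α}
    {X : Ω → Finset α} (hXK : ∀ ω, X ω ⊆ K) (hX : ∀ x, MeasurableSet {ω | x ∈ X ω})
    (p : Finset α → Prop) [DecidablePred p] :
    μ {ω | p (X ω)} = ∑ B ∈ K.powerset.filter p, μ {ω | X ω = B} := by
  rw [← measure_biUnion_finset]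
  · congr 1
    ext ω
    simp [hXK ω]
  · intro B _ C _ hBC
    exact Set.disjoint_left.2 fun ω h1 h2 => hBC (h1.symm.trans h2)
  · intro B _
    exact measurableSet_finset_pred hXK hX fun A => A = B

open Classical in
/-- The occupied points of `K`. -/
noncomputable def occ {d : ℕ} (K : Finset (Zd d)) (Y : Zd d → Bool) : Finset (Zd d) :=
  K.filter fun x => Y x = false

open Classical in
/-- The points of `K` visited by a family of paths. -/
noncomputable def trace {d n : ℕ} (K : Finset (Zd d)) (ω : Fin n → ℕ → Zd d) : Finset (Zd d) :=
  K.filter fun x => ∃ w t, ω w t = x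

lemma mem_occ {d : ℕ} {K : Finset (Zd d)} {Y : Zd d → Bool} {x : Zd d} :
    x ∈ occ K Y ↔ x ∈ K ∧ Y x = false := by simp [occ]

lemma mem_trace {d n : ℕ} {K : Finset (Zd d)} {ω : Fin n → ℕ → Zd d} {x : Zd d} :
    x ∈ trace K ω ↔ x ∈ K ∧ ∃ w t, ω w t = x := by simp [trace]

lemma measurableSet_mem_occ {d : ℕ} (K : Finset (Zd d)) (x : Zd d) :
    MeasurableSet {Y | x ∈ occ K Y} := by
  simp only [mem_occ]
  by_cases hx : x ∈ K
  · simp only [hx, true_and]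
    have : MeasurableSet ((fun Y : Zd d → Bool => Y x) ⁻¹' {false}) :=
      measurable_pi_apply x (MeasurableSet.singleton false)
    exact this
  · simp [hx]

lemma measurableSet_mem_trace {d n : ℕ} (K : Finset (Zd d)) (x : Zd d) :
    MeasurableSet {ω : Fin n → ℕ → Zd d | x ∈ trace K ω} := by
  simp only [mem_trace]
  by_cases hx : x ∈ K
  · simp only [hx, true_and, Set.ofPred_exists]
    refine MeasurableSet.iUnion fun w => MeasurableSet.iUnion fun t => ?_
    have : MeasurableSet ((fun ω : Fin n → ℕ → Zd d => ω w t) ⁻¹' {x}) :=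
      ((measurable_pi_apply t).comp (measurable_pi_apply w)) (MeasurableSet.singleton x)
    exact this
  · simp [hx]

/-- The Poisson weights. -/
noncomputable def poissonWt (u lam : ℝ) (n : ℕ) : ℝ := Real.exp (-lam) * (u ^ n / n.factorial)

lemma tsum_poissonWt_mul {u lam a : ℝ} (hu : 0 ≤ u) (ha : 0 ≤ a) :
    ∑' n, ENNReal.ofReal (poissonWt u lam n) * ENNReal.ofReal a ^ n =
      ENNReal.ofReal (Real.exp (u * a - lam)) := by
  have h1 : ∀ n : ℕ, ENNReal.ofReal (poissonWt u lam n) * ENNReal.ofReal a ^ n =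
      ENNReal.ofReal (Real.exp (-lam)) * ENNReal.ofReal ((u * a) ^ n / n.factorial) := fun n => by
    rw [← ENNReal.ofReal_pow ha, ← ENNReal.ofReal_mul (by unfold poissonWt; positivity),
      ← ENNReal.ofReal_mul (by positivity)]
    congr 1
    unfold poissonWt
    rw [mul_pow]; ring
  simp_rw [h1]
  rw [ENNReal.tsum_mul_left, ← ENNReal.ofReal_tsum_of_nonneg (fun n => by positivity)
    (Real.summable_pow_div_factorial _), ← ENNReal.ofReal_mul (by positivity)]
  congr 1
  have : ∑' n : ℕ, (u * a) ^ n / n.factorial = Real.exp (u * a) := by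
    rw [Real.exp_eq_exp_ℝ, NormedSpace.exp_eq_tsum_div]
  rw [this, ← Real.exp_add]
  congr 1
  ring

/-- Inside a finite set, the occupied points have the law of the trace of a Poisson number of
independent walks started from the equilibrium measure. -/
lemma IsVacantLaw.measure_occ_eq {d : ℕ} (hd : 0 < d) {P : Zd d → Measure (ℕ → Zd d)}
    (hP : IsSRW d P) {u : ℝ} (hu : 0 ≤ u) {Q : Measure (Zd d → Bool)} (hQ : IsVacantLaw P u Q)
    (K : Finset (Zd d)) (p : Finset (Zd d) → Prop) :
    Q {Y | p (occ K Y)} = ∑' n, ENNReal.ofReal (poissonWt u (u * capa P K) n) *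
      Measure.pi (fun _ : Fin n => eqmLaw P K) {ω | p (trace K ω)} := by
  classical
  have hQ1 := hQ.1
  have hfin := isFiniteMeasure_eqmLaw hP K
  have hoK : ∀ Y, occ K Y ⊆ K := fun Y => Finset.filter_subset _ _
  have htK : ∀ (n : ℕ) (ω : Fin n → ℕ → Zd d), trace K ω ⊆ K :=
    fun n ω => Finset.filter_subset _ _
  let f : Finset (Zd d) → ENNReal := fun B => Q {Y | occ K Y = B}
  let g : Finset (Zd d) → ENNReal := fun B =>
    ∑' n, ENNReal.ofReal (poissonWt u (u * capa P K) n) *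
      Measure.pi (fun _ : Fin n => eqmLaw P K) {ω | trace K ω = B}
  have hg : ∀ (p : Finset (Zd d) → Prop) [DecidablePred p], ∑ B ∈ K.powerset.filter p, g B =
      ∑' n, ENNReal.ofReal (poissonWt u (u * capa P K) n) *
        Measure.pi (fun _ : Fin n => eqmLaw P K) {ω | p (trace K ω)} := fun p _ => by
    rw [← Summable.tsum_finsetSum fun _ _ => ENNReal.summable]
    refine tsum_congr fun n => ?_
    rw [← Finset.mul_sum, measure_finset_pred _ (htK n) (measurableSet_mem_trace K) p]
  have hfg : ∀ A ⊆ K, f A = g A := by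
    refine eq_of_sum_powerset_eq (fun B => measure_ne_top _ _) fun A hA => ?_
    have hpow : A.powerset = K.powerset.filter (· ⊆ A) := by
      ext B
      simp only [Finset.mem_powerset, Finset.mem_filter]
      exact ⟨fun h => ⟨h.trans hA, h⟩, fun h => h.2⟩
    have hS : K \ A ⊆ K := Finset.sdiff_subset
    rw [hpow]
    refine (measure_finset_pred Q hoK (measurableSet_mem_occ K) (fun B => B ⊆ A)).symm.trans
      (Eq.trans ?_ (hg fun B => B ⊆ A).symm)
    have h1 : {Y | occ K Y ⊆ A} = {Y | ∀ x ∈ K \ A, Y x = true} := by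
      ext Y
      simp only [Set.mem_ofPred_eq, Finset.subset_iff, mem_occ, Finset.mem_sdiff]
      refine forall_congr' fun x => ?_
      cases Y x <;> by_cases hxA : x ∈ A <;> simp [hxA]
    have h2 : ∀ n : ℕ, {ω : Fin n → ℕ → Zd d | trace K ω ⊆ A} =
        Set.pi Set.univ fun _ => (hitIn ↑(K \ A) Set.univ)ᶜ := fun n => by
      ext ω
      simp only [Set.mem_ofPred_eq, Finset.subset_iff, mem_trace, Set.mem_pi, Set.mem_univ,
        true_imp_iff, Set.mem_compl_iff, hitIn_univ, not_exists, Finset.coe_sdiff, Set.mem_sdiff,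
        Finset.mem_coe]
      constructor
      · intro h w t ⟨h1, h2⟩
        exact h2 (h ⟨h1, w, t, rfl⟩)
      · rintro h x ⟨hx, w, t, rfl⟩
        by_contra hc
        exact h w t ⟨hx, hc⟩
    have h3 : ∀ n : ℕ, Measure.pi (fun _ : Fin n => eqmLaw P K)
        {ω : Fin n → ℕ → Zd d | trace K ω ⊆ A} =
        ENNReal.ofReal (capa P K - capa P (K \ A)) ^ n := fun n => by
      rw [h2, Measure.pi_pi]
      simp [-Finset.coe_sdiff, eqmLaw_avoid hd hP hS]
    rw [h1, hQ.2]
    simp_rw [h3]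
    rw [tsum_poissonWt_mul hu (eqmLaw_avoid_nonneg hd hP hS)]
    congr 2
    ring
  rw [measure_finset_pred Q hoK (measurableSet_mem_occ K) p, ← hg p]
  exact Finset.sum_congr rfl fun B hB =>
    hfg B (Finset.mem_powerset.1 (Finset.mem_filter.1 hB).1)

lemma exists_le_abs_of_eqm_ne_zero {d : ℕ} (hd : 0 < d) {P : Zd d → Measure (ℕ → Zd d)}
    (hP : IsSRW d P) {N : ℕ} {x : Zd d} (hx : x ∈ fbox d N)
    (h : eqm P (↑(fbox d N)) x ≠ 0) : ∃ i, (N : ℤ) ≤ |x i| := by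
  by_contra! hc
  refine h (eqm_eq_zero_of_interior hd hP (Finset.mem_coe.2 hx) fun e => ?_)
  rw [Finset.mem_coe, mem_fbox]
  intro i
  have h1 : |stepVec e i| ≤ 1 := by
    unfold stepVec
    by_cases hi : i = e.1
    · subst hi
      rw [Pi.single_eq_same]
      split_ifs <;> simp
    · simp [Pi.single_eq_of_ne hi]
  have h2 := abs_add_le (x i) (stepVec e i)
  have h3 := hc i
  rw [Pi.add_apply]
  omega

namespace RingSystem

/-- Each family has a vertical translate, with centre in the strip, all of whose rings meet `B`. -/
def good {L p J : ℕ} (S : RingSystem L p J) (d : ℕ) (B : Finset (Zd d)) : Prop :=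
  ∀ i, ∃ y : ℤ, (0 ≤ y ∧ y ≤ 6 * L) ∧ ∀ k, ∃ x ∈ B, x ∈ sqRing d (S.abscissa i) y (S.rad k)

/-- The rings to be visited by the walk `w`, when in the `i`-th family the centre is visited by the
walk `(τ i).1`, which visits all the rings if it coincides with `(τ i).2.1`, while otherwise
`(τ i).2.1` visits the ring `(τ i).2.2`. -/
def task {n p J : ℕ} (τ : Fin p → Fin n × Fin n × Fin J) (w : Fin n) :
    Finset (Fin p × Fin (J + 1)) :=
  Finset.univ.filter fun b =>
    if (τ b.1).1 = (τ b.1).2.1 then w = (τ b.1).1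
    else (w = (τ b.1).1 ∧ b.2 = 0) ∨ (w = (τ b.1).2.1 ∧ b.2 = (τ b.1).2.2.succ)

lemma exists_task_of_good {L p J n : ℕ} (S : RingSystem L p J) (hJ : 0 < J) {d : ℕ}
    {K : Finset (Zd d)} {ω : Fin n → ℕ → Zd d} (h : S.good d (trace K ω)) :
    ∃ (y : Fin p → Fin (6 * L + 1)) (τ : Fin p → Fin n × Fin n × Fin J),
      ∀ w, ω w ∈ hitAll (S.ring d fun i => (y i : ℕ)) (task τ w) := by
  have key : ∀ i, ∃ (y : Fin (6 * L + 1)) (τ : Fin n × Fin n × Fin J),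
      (∃ t, ω τ.1 t ∈ sqRing d (S.abscissa i) (y : ℕ) (S.rad 0)) ∧
      (if τ.1 = τ.2.1 then ∀ k, ∃ t, ω τ.1 t ∈ sqRing d (S.abscissa i) (y : ℕ) (S.rad k)
        else ∃ t, ω τ.2.1 t ∈ sqRing d (S.abscissa i) (y : ℕ) (S.rad τ.2.2.succ)) := by
    intro i
    obtain ⟨y, ⟨hy0, hy1⟩, hk⟩ := h i
    lift y to ℕ using hy0
    have hvis : ∀ k, ∃ w t, ω w t ∈ sqRing d (S.abscissa i) y (S.rad k) := fun k => by
      obtain ⟨x, hx, hxr⟩ := hk k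
      obtain ⟨-, w, t, rfl⟩ := mem_trace.1 hx
      exact ⟨w, t, hxr⟩
    obtain ⟨a, t, hat⟩ := hvis 0
    refine ⟨⟨y, by omega⟩, ?_⟩
    by_cases hall : ∀ k, ∃ t, ω a t ∈ sqRing d (S.abscissa i) y (S.rad k)
    · exact ⟨(a, a, ⟨0, hJ⟩), ⟨t, hat⟩, by simpa using hall⟩
    · push Not at hall
      obtain ⟨k, hk⟩ := hall
      have hk0 : k ≠ 0 := by rintro rfl; exact hk t hat
      obtain ⟨j, rfl⟩ := Fin.exists_succ_eq.2 hk0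
      obtain ⟨b, t', hb⟩ := hvis j.succ
      have hab : a ≠ b := by rintro rfl; exact hk t' hb
      refine ⟨(a, b, j), ⟨t, hat⟩, ?_⟩
      rw [if_neg hab]
      exact ⟨t', hb⟩
  choose y τ h0 h1 using key
  refine ⟨y, τ, fun w => ?_⟩
  rintro ⟨i, k⟩ hb
  have hb' := (Finset.mem_filter.1 hb).2
  have h2 := h1 i
  simp only [ring]
  by_cases he : (τ i).1 = (τ i).2.1
  · rw [if_pos he] at h2
    simp only [he, if_true] at hb' h2
    subst hb'
    exact h2 k
  · rw [if_neg he] at h2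
    simp only [he, if_false] at hb'
    rcases hb' with ⟨rfl, rfl⟩ | ⟨rfl, rfl⟩
    · exact h0 i
    · exact h2

lemma slice_task {n p J : ℕ} (τ : Fin p → Fin n × Fin n × Fin J) (w : Fin n) (i : Fin p) :
    slice (task τ w) i =
      if (τ i).1 = (τ i).2.1 then (if w = (τ i).1 then Finset.univ else ∅)
      else if w = (τ i).1 then {0} else if w = (τ i).2.1 then {(τ i).2.2.succ} else ∅ := by
  ext k
  simp only [slice, task, Finset.mem_filter, Finset.mem_univ, true_and]
  split_ifs with h1 h2 h3 h4
  · simp [h2]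
  · simp [h2]
  · subst h3; simp [h1]
  · subst h4; simp [h3]
  · simp [h3, h4]

lemma prod_famProb_slice_task_le {L p J n : ℕ} (S : RingSystem L p J) {α : ℝ}
    (h1 : S.famProb Finset.univ ≤ α)
    (h2 : ∀ j : Fin J, S.famProb {0} * S.famProb {j.succ} ≤ α)
    (τ : Fin p → Fin n × Fin n × Fin J) (i : Fin p) :
    ∏ w, S.famProb (slice (task τ w) i) ≤ α := by
  simp_rw [slice_task]
  by_cases he : (τ i).1 = (τ i).2.1
  · simp only [if_pos he]
    rw [Finset.prod_eq_single (τ i).1]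
    · simpa using h1
    · intro b _ hb
      rw [if_neg hb, famProb_empty]
    · simp
  · simp only [if_neg he]
    rw [Finset.prod_eq_mul (τ i).1 (τ i).2.1 he]
    · simpa [Ne.symm he] using h2 (τ i).2.2
    · rintro c - ⟨hc1, hc2⟩
      rw [if_neg hc1, if_neg hc2, famProb_empty]
    · simp
    · simp

lemma eqmLaw_hitAll_le {L p J : ℕ} (S : RingSystem L p J) {d : ℕ} (hd : 3 ≤ d)
    {P : Zd d → Measure (ℕ → Zd d)} (hP : IsSRW d P) {y : Fin p → ℤ}
    (hy : ∀ i, 0 ≤ y i ∧ y i ≤ 6 * L) (R : Finset (Fin p × Fin (J + 1))) :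
    eqmLaw P (fbox d (7 * L)) (hitAll (S.ring d y) R) ≤
      ENNReal.ofReal (capa P (fbox d (7 * L)) * ∏ i, S.famProb (slice R i)) := by
  rw [eqmLaw_apply hP, capa, Finset.sum_mul]
  refine ENNReal.ofReal_le_ofReal (Finset.sum_le_sum fun x hx => ?_)
  by_cases h : eqm P (↑(fbox d (7 * L))) x = 0
  · simp [h]
  · refine mul_le_mul_of_nonneg_left (S.real_hitAll_ring_le hd hP hy R ?_) (eqm_nonneg _ _ _)
    obtain ⟨i, hi⟩ := exists_le_abs_of_eqm_ne_zero (by omega) hP hx h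
    exact ⟨i, by exact_mod_cast hi⟩

lemma pi_eqmLaw_good_le {L p J : ℕ} (S : RingSystem L p J) (hJ : 0 < J) {d : ℕ} (hd : 3 ≤ d)
    {P : Zd d → Measure (ℕ → Zd d)} (hP : IsSRW d P) {α : ℝ}
    (h1 : S.famProb Finset.univ ≤ α)
    (h2 : ∀ j : Fin J, S.famProb {0} * S.famProb {j.succ} ≤ α) (n : ℕ) :
    Measure.pi (fun _ : Fin n => eqmLaw P (fbox d (7 * L)))
      {ω | S.good d (trace (fbox d (7 * L)) ω)} ≤
      ENNReal.ofReal (capa P (fbox d (7 * L)) ^ n *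
        ((n : ℝ) ^ (2 * p) * ((6 * L + 1) * J * α) ^ p)) := by
  have hfin := isFiniteMeasure_eqmLaw hP (fbox d (7 * L))
  have hα : 0 ≤ α := (S.famProb_nonneg _).trans h1
  set cp := capa P (fbox d (7 * L)) with hcp
  have hcp0 : 0 ≤ cp := capa_nonneg _ _
  have hone : ∀ (y : Fin p → Fin (6 * L + 1)) (τ : Fin p → Fin n × Fin n × Fin J),
      Measure.pi (fun _ : Fin n => eqmLaw P (fbox d (7 * L)))
        (Set.pi Set.univ fun w => hitAll (S.ring d fun i => (y i : ℕ)) (task τ w)) ≤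
      ENNReal.ofReal (cp ^ n * α ^ p) := fun y τ => by
    rw [Measure.pi_pi]
    calc _ ≤ ∏ w, ENNReal.ofReal (cp * ∏ i, S.famProb (slice (task τ w) i)) :=
          Finset.prod_le_prod' fun w _ => S.eqmLaw_hitAll_le hd hP (fun i =>
            ⟨by positivity, by have := (y i).2; omega⟩) _
      _ = ENNReal.ofReal (∏ w, (cp * ∏ i, S.famProb (slice (task τ w) i))) :=
          (ENNReal.ofReal_prod_of_nonneg fun w _ => mul_nonneg hcp0
            (Finset.prod_nonneg fun i _ => S.famProb_nonneg _)).symm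
      _ ≤ _ := by
          refine ENNReal.ofReal_le_ofReal ?_
          rw [Finset.prod_mul_distrib, Finset.prod_const, Finset.card_univ, Fintype.card_fin,
            Finset.prod_comm]
          refine mul_le_mul_of_nonneg_left ?_ (by positivity)
          calc _ ≤ ∏ _i : Fin p, α := Finset.prod_le_prod
                (fun i _ => Finset.prod_nonneg fun w _ => S.famProb_nonneg _)
                fun i _ => S.prod_famProb_slice_task_le h1 h2 τ i
            _ = α ^ p := by simp
  calc _ ≤ Measure.pi (fun _ : Fin n => eqmLaw P (fbox d (7 * L)))
        (⋃ q : (Fin p → Fin (6 * L + 1)) × (Fin p → Fin n × Fin n × Fin J),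
          Set.pi Set.univ fun w => hitAll (S.ring d fun i => (q.1 i : ℕ)) (task q.2 w)) := by
        refine measure_mono fun ω hω => ?_
        obtain ⟨y, τ, h⟩ := S.exists_task_of_good hJ hω
        exact Set.mem_iUnion.2 ⟨(y, τ), fun w _ => h w⟩
    _ ≤ ∑ _q : (Fin p → Fin (6 * L + 1)) × (Fin p → Fin n × Fin n × Fin J),
          ENNReal.ofReal (cp ^ n * α ^ p) :=
        (measure_iUnion_fintype_le _ _).trans (Finset.sum_le_sum fun q _ => hone q.1 q.2)
    _ = _ := by
        rw [Finset.sum_const, nsmul_eq_mul, ← ENNReal.ofReal_natCast,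
          ← ENNReal.ofReal_mul (by positivity)]
        congr 1
        simp only [Finset.card_univ, Fintype.card_prod, Fintype.card_fun, Fintype.card_fin]
        push_cast
        rw [mul_pow ((6 * L + 1 : ℝ) * J) α p, mul_pow (6 * L + 1 : ℝ) J p]
        ring

lemma measure_good_le {L p J : ℕ} (S : RingSystem L p J) (hJ : 0 < J) {d : ℕ} (hd : 3 ≤ d)
    {P : Zd d → Measure (ℕ → Zd d)} (hP : IsSRW d P) {α : ℝ}
    (h1 : S.famProb Finset.univ ≤ α)
    (h2 : ∀ j : Fin J, S.famProb {0} * S.famProb {j.succ} ≤ α)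
    {u : ℝ} (hu : 0 ≤ u) {Q : Measure (Zd d → Bool)} (hQ : IsVacantLaw P u Q) :
    Q {Y | S.good d (occ (fbox d (7 * L)) Y)} ≤
      ENNReal.ofReal (Real.exp (2 * (u * capa P (fbox d (7 * L)))) *
        (4 * p ^ 2 * ((6 * L + 1) * J * α)) ^ p) := by
  have hα : 0 ≤ α := (S.famProb_nonneg _).trans h1
  rw [hQ.measure_occ_eq (by omega) hP hu]
  set cp := capa P (fbox d (7 * L)) with hcp
  have hcp0 : 0 ≤ cp := capa_nonneg _ _
  set X : ℝ := (6 * L + 1) * J * α with hX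
  have hX0 : 0 ≤ X := by positivity
  have hterm : ∀ n : ℕ, ENNReal.ofReal (poissonWt u (u * cp) n) *
      Measure.pi (fun _ : Fin n => eqmLaw P (fbox d (7 * L)))
        {ω | S.good d (trace (fbox d (7 * L)) ω)} ≤
      ENNReal.ofReal (((2 * p : ℕ).factorial : ℝ) * X ^ p) *
        (ENNReal.ofReal (poissonWt u (u * cp) n) * ENNReal.ofReal (Real.exp 1 * cp) ^ n) := by
    intro n
    have hw : 0 ≤ poissonWt u (u * cp) n := by unfold poissonWt; positivity
    refine (mul_le_mul_right (S.pi_eqmLaw_good_le hJ hd hP h1 h2 n) _).trans ?_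
    rw [← ENNReal.ofReal_pow (by positivity), ← ENNReal.ofReal_mul hw, ← ENNReal.ofReal_mul hw,
      ← ENNReal.ofReal_mul (by positivity)]
    refine ENNReal.ofReal_le_ofReal ?_
    have h3 := Real.pow_div_factorial_le_exp n (by positivity) (2 * p)
    rw [div_le_iff₀ (by positivity)] at h3
    have h4 : Real.exp n = Real.exp 1 ^ n := by rw [← Real.exp_nat_mul, mul_one]
    rw [h4] at h3
    calc poissonWt u (u * cp) n * (cp ^ n * ((n : ℝ) ^ (2 * p) * X ^ p))
        ≤ poissonWt u (u * cp) n *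
            (cp ^ n * (Real.exp 1 ^ n * ((2 * p : ℕ).factorial : ℝ) * X ^ p)) := by gcongr
      _ = _ := by rw [mul_pow]; ring
  refine (ENNReal.tsum_le_tsum hterm).trans ?_
  rw [ENNReal.tsum_mul_left, tsum_poissonWt_mul hu (by positivity),
    ← ENNReal.ofReal_mul (by positivity), mul_comm]
  refine ENNReal.ofReal_le_ofReal ?_
  rw [mul_pow (4 * (p : ℝ) ^ 2)]
  have hfact : ((2 * p : ℕ).factorial : ℝ) ≤ (4 * (p : ℝ) ^ 2) ^ p := by
    have : ((2 * p).factorial : ℝ) ≤ ((2 * p) ^ (2 * p) : ℕ) := by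
      exact_mod_cast Nat.factorial_le_pow (2 * p)
    refine this.trans (le_of_eq ?_)
    push_cast
    rw [pow_mul]
    congr 1
    ring
  gcongr
  have := Real.exp_one_lt_three
  have h5 : 0 ≤ u * cp := by positivity
  nlinarith

end RingSystem

lemma exists_eq_of_abs_sub_le_one {f : ℕ → ℤ} {m : ℤ} {n : ℕ}
    (h : ∀ k < n, |f (k + 1) - f k| ≤ 1) (h0 : f 0 ≤ m) (hn : m ≤ f n) : ∃ k ≤ n, f k = m := by
  induction n with
  | zero => exact ⟨0, le_rfl, le_antisymm h0 hn⟩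
  | succ n ih =>
    by_cases hm : m ≤ f n
    · obtain ⟨k, hk, hkm⟩ := ih (fun k hk => h k (by omega)) hm
      exact ⟨k, by omega, hkm⟩
    · have := abs_le.1 (h n (by omega))
      exact ⟨n + 1, le_rfl, by omega⟩

lemma inPlane.eq_planePt {d : ℕ} {x : Zd d} (h : inPlane x) :
    x = planePt d (coord x 0) (coord x 1) := by
  ext i
  unfold planePt coord
  obtain ⟨i, hi⟩ := i
  rcases i with _ | _ | i
  · simp [hi]
  · simp [hi]
  · simpa using h ⟨i + 2, hi⟩ (by simp)

lemma starAdj.abs_coord_sub_le {d : ℕ} {x y : Zd d} (h : starAdj x y) (k : ℕ) :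
    |coord y k - coord x k| ≤ 1 := by
  unfold coord
  split_ifs with hk
  · rw [abs_sub_comm]; exact h.2 _
  · simp

namespace RingSystem

lemma good_of_hasStarPath {L p J : ℕ} (S : RingSystem L p J) {d : ℕ} {Y : Zd d → Bool}
    (h : HasStarPath
      {x : Zd d | inPlane x ∧ coord x 0 = 0 ∧ 0 ≤ coord x 1 ∧ coord x 1 ≤ (6 * L : ℤ)}
      {x : Zd d | inPlane x ∧ coord x 0 = (2 * L : ℤ) - 1 ∧
        0 ≤ coord x 1 ∧ coord x 1 ≤ (6 * L : ℤ)}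
      {x : Zd d | inPlane x ∧ 0 ≤ coord x 0 ∧ coord x 0 ≤ (2 * L : ℤ) ∧
        0 ≤ coord x 1 ∧ coord x 1 ≤ (6 * L : ℤ) ∧ Y x = false}) :
    S.good d (occ (fbox d (7 * L)) Y) := by
  obtain ⟨N, w, hw0, hwN, hw, hadj⟩ := h
  intro i
  obtain ⟨k, hk, hki⟩ : ∃ k ≤ N, coord (w k) 0 = S.abscissa i := by
    refine exists_eq_of_abs_sub_le_one (f := fun k => coord (w k) 0)
      (fun k hk => (hadj k hk).abs_coord_sub_le 0) ?_ ?_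
    · simp only [hw0.2.1]
      exact (S.abscissa_pos i).le
    · simp only [hwN.2.1]
      have := S.abscissa_lt i
      omega
  refine ⟨coord (w k) 1, ⟨(hw k hk).2.2.2.1, (hw k hk).2.2.2.2.1⟩, fun j => ?_⟩
  set D : ℕ → ℤ := fun m =>
    max |coord (w m) 0 - S.abscissa i| |coord (w m) 1 - coord (w k) 1| with hD
  obtain ⟨m, hm, hmD⟩ : ∃ m ≤ k, -D m = -(S.rad j : ℤ) := by
    refine exists_eq_of_abs_sub_le_one (f := fun m => -D m) (fun m hm => ?_) ?_ ?_
    · have h1 := (hadj m (by omega)).abs_coord_sub_le 0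
      have h2 := (hadj m (by omega)).abs_coord_sub_le 1
      rw [neg_sub_neg, abs_sub_comm]
      refine (abs_max_sub_max_le_max _ _ _ _).trans (max_le ?_ ?_)
      · refine (abs_abs_sub_abs_le _ _).trans ?_
        rwa [sub_sub_sub_cancel_right]
      · refine (abs_abs_sub_abs_le _ _).trans ?_
        rwa [sub_sub_sub_cancel_right]
    · have h1 : S.abscissa i ≤ D 0 := by
        refine le_trans ?_ (le_max_left _ _)
        rw [hw0.2.1, zero_sub, abs_neg]
        exact le_abs_self _
      have h2 := (le_max_left _ _).trans (S.rad_le j)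
      have h3 := S.four_mul_le
      have h4 : (S.gap : ℤ) ≤ S.abscissa i := by
        unfold abscissa
        nlinarith [S.gap_pos]
      change -D 0 ≤ _
      omega
    · simp [hD, hki]
  have hmN : m ≤ N := hm.trans hk
  obtain ⟨hpl, h0, h1, h2, h3, hY⟩ := hw m hmN
  refine ⟨w m, mem_occ.2 ⟨?_, hY⟩, ?_⟩
  · rw [mem_fbox, hpl.eq_planePt]
    push_cast
    exact abs_planePt_le (by rw [abs_of_nonneg h0]; omega) (by rw [abs_of_nonneg h2]; omega)
  · refine ⟨coord (w m) 0 - S.abscissa i, coord (w m) 1 - coord (w k) 1, ?_, by simpa using hmD⟩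
    rw [add_sub_cancel, add_sub_cancel]
    exact hpl.eq_planePt

lemma measure_crossing_le {L p J : ℕ} (S : RingSystem L p J) (hJ : 0 < J) {d : ℕ} (hd : 3 ≤ d)
    {P : Zd d → Measure (ℕ → Zd d)} (hP : IsSRW d P) {α : ℝ}
    (h1 : S.famProb Finset.univ ≤ α)
    (h2 : ∀ j : Fin J, S.famProb {0} * S.famProb {j.succ} ≤ α)
    {u : ℝ} (hu : 0 ≤ u) {Q : Measure (Zd d → Bool)} (hQ : IsVacantLaw P u Q) :
    (Q {Y | HasStarPath
      {x : Zd d | inPlane x ∧ coord x 0 = 0 ∧ 0 ≤ coord x 1 ∧ coord x 1 ≤ (6 * L : ℤ)}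
      {x : Zd d | inPlane x ∧ coord x 0 = (2 * L : ℤ) - 1 ∧
        0 ≤ coord x 1 ∧ coord x 1 ≤ (6 * L : ℤ)}
      {x : Zd d | inPlane x ∧ 0 ≤ coord x 0 ∧ coord x 0 ≤ (2 * L : ℤ) ∧
        0 ≤ coord x 1 ∧ coord x 1 ≤ (6 * L : ℤ) ∧ Y x = false}}).toReal ≤
      Real.exp (2 * (u * capa P (fbox d (7 * L)))) * (4 * p ^ 2 * ((6 * L + 1) * J * α)) ^ p := by
  have hα : 0 ≤ α := (S.famProb_nonneg _).trans h1
  exact ENNReal.toReal_le_of_le_ofReal (by positivity)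
    ((measure_mono fun Y hY => S.good_of_hasStarPath hY).trans
      (S.measure_good_le hJ hd hP h1 h2 hu hQ))

end RingSystem

namespace RingSystem

/-- The ring system with radii `0, M, 2M, 4M, …`. -/
def dyadic {L p J M gap : ℕ} (hM : 2 ≤ M) (h4 : 4 * (2 ^ J * M) ≤ gap)
    (hp : 2 * p * (2 ^ J * M) ≤ gap) (hL : p * gap < 2 * L) : RingSystem L p J where
  gap := gap
  rad k := if k = 0 then 0 else 2 ^ (k.val - 1) * M
  maxRad := 2 ^ J * M
  rad_zero := by simp
  two_le_rad k hk := by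
    rw [if_neg hk]
    exact hM.trans (Nat.le_mul_of_pos_left _ (by positivity))
  two_mul_rad_le j k hjk := by
    have hk : k ≠ 0 := by rintro rfl; exact absurd hjk (Fin.not_lt_zero _)
    rw [if_neg hk]
    split_ifs with hj
    · simpa using hM.trans (Nat.le_mul_of_pos_left M (by positivity : 0 < 2 ^ (k.val - 1)))
    · have h1 : 0 < j.val := Nat.pos_of_ne_zero fun h => hj (Fin.ext h)
      have h2 : j.val < k.val := hjk
      rw [max_eq_left (Nat.mul_pos (by positivity) (by omega)), ← mul_assoc, ← pow_succ']
      exact Nat.mul_le_mul_right _ (Nat.pow_le_pow_right (by norm_num) (by omega))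
  rad_le k := by
    have h1 : 1 ≤ 2 ^ J * M := Nat.mul_pos (by positivity) (by omega)
    refine max_le ?_ h1
    split_ifs with hk
    · exact Nat.zero_le _
    · exact Nat.mul_le_mul_right _ (Nat.pow_le_pow_right (by norm_num) (by omega))
  four_mul_le := h4
  mul_maxRad_le := hp
  mul_gap_lt := hL

lemma const_dyadic_le {L p J M gap : ℕ} (hM : 2 ≤ M) (h4 : 4 * (2 ^ J * M) ≤ gap)
    (hp : 2 * p * (2 ^ J * M) ≤ gap) (hL : p * gap < 2 * L) (j : Fin J) :
    (dyadic hM h4 hp hL).const j.succ ≤ 72 / Real.log M := by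
  have h1 : M ≤ 2 ^ j.val * M := Nat.le_mul_of_pos_left M (by positivity)
  have h2 : (dyadic hM h4 hp hL).rad j.succ = 2 ^ j.val * M := by
    simp [dyadic]
  unfold const ringC
  rw [h2, if_neg (by positivity)]
  have h3 : 0 < Real.log M := Real.log_pos (by exact_mod_cast hM)
  gcongr

lemma const_zero {L p J : ℕ} (S : RingSystem L p J) : S.const 0 = 3 := by
  simp [const, ringC, S.rad_zero]

lemma famProb_univ_le {L p J : ℕ} (S : RingSystem L p J) {A : ℝ}
    (hA : ∀ j : Fin J, 2 * (J + 1) * S.const j.succ ≤ A) :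
    S.famProb Finset.univ ≤ 12 * (J + 1) * p / S.gap * A ^ J := by
  have hg : (0 : ℝ) < S.gap := by exact_mod_cast S.gap_pos
  unfold famProb famBd
  simp only [weight, Finset.univ_nonempty.ne_empty, Finset.mem_univ, if_true, if_false,
    Fintype.card_fin]
  rw [Fin.prod_univ_succ, S.const_zero]
  have h1 : ∏ j : Fin J, (2 * ((J + 1 : ℕ) : ℝ) * S.const j.succ) ≤ A ^ J := by
    calc _ ≤ ∏ _j : Fin J, A := Finset.prod_le_prod
          (fun j _ => by have := S.const_pos j.succ; positivity)
          fun j _ => by push_cast; exact hA j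
      _ = A ^ J := by simp
  calc _ ≤ 2 * ((J + 1 : ℕ) : ℝ) * 3 * A ^ J * (p / (S.gap / 2)) := by gcongr
    _ = _ := by push_cast; field_simp; ring

lemma famProb_zero {L p J : ℕ} (S : RingSystem L p J) :
    S.famProb {0} = 12 * (J + 1) * p / S.gap := by
  have hg : (0 : ℝ) < S.gap := by exact_mod_cast S.gap_pos
  unfold famProb famBd
  simp only [weight, Finset.singleton_ne_empty, Finset.mem_singleton, if_true, if_false,
    Fintype.card_fin, Finset.prod_singleton, S.const_zero]
  push_cast
  field_simp
  ring

lemma famProb_succ_le {L p J : ℕ} (S : RingSystem L p J) {A : ℝ}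
    (hA : ∀ j : Fin J, 2 * (J + 1) * S.const j.succ ≤ A) (j : Fin J) :
    S.famProb {j.succ} ≤ A * (2 * p * S.maxRad / S.gap) := by
  have hg : (0 : ℝ) < S.gap := by exact_mod_cast S.gap_pos
  unfold famProb famBd
  simp only [weight, Finset.singleton_ne_empty, Finset.mem_singleton, if_false,
    (Fin.succ_ne_zero j).symm, Fintype.card_fin, Finset.prod_singleton]
  have h1 := hA j
  calc _ = (2 * (J + 1) * S.const j.succ) * (2 * p * S.maxRad / S.gap) := by
        push_cast; field_simp
    _ ≤ _ := by gcongr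

end RingSystem

lemma level_mul_capa_le {d : ℕ} (hd : 3 ≤ d) {P : Zd d → Measure (ℕ → Zd d)} (hP : IsSRW d P)
    {κ : ℝ} (hκ : 0 ≤ κ) {L : ℕ} (hL : 0 < L) :
    κ * (Real.log L) ^ 2 * (L : ℝ) ^ (-((d : ℝ) - 2)) * capa P (fbox d (7 * L)) ≤
      κ * (29 * d) ^ d * (Real.log L) ^ 2 := by
  have hL1 : (1 : ℝ) ≤ L := by exact_mod_cast hL
  have hL0 : (0 : ℝ) < L := by linarith
  have hd1 : (3 : ℝ) ≤ d := by exact_mod_cast hd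
  have h1 := capa_fbox_le (by omega) hP (7 * L) (by omega)
  have hc := capa_nonneg P (fbox d (7 * L))
  have h2 : capa P (fbox d (7 * L)) * (L : ℝ) ^ 2 ≤ (29 * d * L) ^ d := by
    refine le_trans ?_ (h1.trans ?_)
    · refine mul_le_mul_of_nonneg_left ?_ hc
      push_cast
      nlinarith [sq_nonneg (L : ℝ)]
    · push_cast
      gcongr
      nlinarith
  have h3 : (L : ℝ) ^ (-((d : ℝ) - 2)) * (L : ℝ) ^ d = (L : ℝ) ^ 2 := by
    rw [← Real.rpow_natCast, ← Real.rpow_natCast, ← Real.rpow_add hL0]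
    congr 1
    push_cast
    ring
  have h4 : (L : ℝ) ^ (-((d : ℝ) - 2)) * capa P (fbox d (7 * L)) ≤ (29 * d) ^ d := by
    have h5 : (L : ℝ) ^ (-((d : ℝ) - 2)) * capa P (fbox d (7 * L)) * L ^ 2 ≤
        (29 * d) ^ d * (L : ℝ) ^ 2 := by
      calc _ = (L : ℝ) ^ (-((d : ℝ) - 2)) * (capa P (fbox d (7 * L)) * L ^ 2) := by ring
        _ ≤ (L : ℝ) ^ (-((d : ℝ) - 2)) * (29 * d * L) ^ d := by gcongr
        _ = (29 * d) ^ d * ((L : ℝ) ^ (-((d : ℝ) - 2)) * L ^ d) := by rw [mul_pow]; ring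
        _ = _ := by rw [h3]
    exact le_of_mul_le_mul_right h5 (by positivity)
  calc _ = κ * (Real.log L) ^ 2 * ((L : ℝ) ^ (-((d : ℝ) - 2)) * capa P (fbox d (7 * L))) := by ring
    _ ≤ κ * (Real.log L) ^ 2 * (29 * d) ^ d := by gcongr
    _ = _ := by ring

namespace RingSystem

lemma bracket_le {L p J : ℕ} (S : RingSystem L p J) {D x y α : ℝ} (hx : 40000 ≤ x)
    (hxy : 200 * x ≤ y) (hy : y ^ 2 = x ^ 3) (hL : (L : ℝ) = Real.exp (y ^ 2))
    (hJ : J ≤ y) (hJ' : y ≤ J + 1) (hp : p ≤ Real.exp (2 * x)) (hD : S.maxRad ≤ D)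
    (hD' : D ≤ Real.exp (1 + y + y ^ 2 / 4)) (hLg : (L : ℝ) ≤ p * S.gap)
    (hα : α = 12 * (J + 1) * p / S.gap *
      (Real.exp (-1) ^ J + Real.exp (-1) * (2 * p * S.maxRad / S.gap))) :
    4 * p ^ 2 * ((6 * L + 1) * J * α) ≤ Real.exp (-3) := by
  have hg : (0 : ℝ) < S.gap := by exact_mod_cast S.gap_pos
  have hL0 : (0 : ℝ) < L := by rw [hL]; positivity
  have hD0 : 0 ≤ D := (Nat.cast_nonneg _).trans hD
  have hL1 : (1 : ℝ) ≤ L := by exact_mod_cast (by exact_mod_cast hL0 : 0 < L)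
  have hginv : 1 / (S.gap : ℝ) ≤ p / L := by
    rw [div_le_div_iff₀ hg hL0, one_mul]; exact hLg
  have he1 : Real.exp (-1) ≤ 1 := Real.exp_le_one_iff.2 (by norm_num)
  have hJe : Real.exp (-1) ^ J ≤ Real.exp (1 - y) := by
    rw [← Real.exp_nat_mul]
    exact Real.exp_le_exp.2 (by linarith)
  have h2e : (2 : ℝ) ≤ Real.exp 1 := by have := Real.add_one_le_exp (1 : ℝ); linarith
  have hsec : Real.exp (-1) * (2 * p * S.maxRad / S.gap) ≤
      Real.exp (4 * x + 2 + y - 3 / 4 * y ^ 2) := by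
    calc _ ≤ 1 * (2 * p * S.maxRad * (1 / S.gap) : ℝ) := by
          rw [mul_one_div]; gcongr
      _ ≤ 1 * (2 * p * D * (p / L)) := by gcongr
      _ = 2 * p ^ 2 * D / L := by ring
      _ ≤ Real.exp 1 * Real.exp (2 * x) ^ 2 * Real.exp (1 + y + y ^ 2 / 4) / L := by gcongr
      _ = _ := by
          rw [hL, ← Real.exp_nat_mul, ← Real.exp_add, ← Real.exp_add, ← Real.exp_sub]
          congr 1
          push_cast
          ring
  have hpoly : 672 * y ^ 2 ≤ Real.exp x := by
    have h1 := Real.pow_div_factorial_le_exp x (by linarith) 4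
    have h2 : ((4 : ℕ).factorial : ℝ) = 24 := by norm_num [Nat.factorial]
    rw [h2] at h1
    refine le_trans ?_ h1
    rw [hy, le_div_iff₀ (by norm_num)]
    have : 0 ≤ x ^ 3 := by positivity
    nlinarith
  have hy0 : 8000000 ≤ y := by linarith
  calc 4 * p ^ 2 * ((6 * L + 1) * J * α)
      = 4 * p ^ 2 * ((6 * L + 1) * J * (12 * (J + 1) * p * (1 / S.gap) *
        (Real.exp (-1) ^ J + Real.exp (-1) * (2 * p * S.maxRad / S.gap)))) := by
        rw [hα, mul_one_div]
    _ ≤ 4 * p ^ 2 * ((7 * L) * y * (12 * (2 * y) * p * (p / L) *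
        (Real.exp (1 - y) + Real.exp (4 * x + 2 + y - 3 / 4 * y ^ 2)))) := by
        gcongr
        · linarith
        · linarith
    _ = 672 * y ^ 2 * (p : ℝ) ^ 4 *
        (Real.exp (1 - y) + Real.exp (4 * x + 2 + y - 3 / 4 * y ^ 2)) := by
        field_simp
        ring
    _ ≤ Real.exp x * Real.exp (2 * x) ^ 4 *
        (Real.exp (1 - y) + Real.exp (4 * x + 2 + y - 3 / 4 * y ^ 2)) := by gcongr
    _ = Real.exp (9 * x + (1 - y)) + Real.exp (9 * x + (4 * x + 2 + y - 3 / 4 * y ^ 2)) := by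
        rw [← Real.exp_nat_mul, ← Real.exp_add, mul_add, ← Real.exp_add, ← Real.exp_add]
        congr 2 <;> · push_cast; ring
    _ ≤ Real.exp (-4) + Real.exp (-4) := by
        gcongr
        · linarith
        · nlinarith
    _ = 2 * Real.exp (-4) := by ring
    _ ≤ Real.exp 1 * Real.exp (-4) := by gcongr
    _ = Real.exp (-3) := by rw [← Real.exp_add]; norm_num

end RingSystem

lemma exists_ringSystem {s : ℝ} (hs : 200 ≤ s) {L : ℕ} (hL : (L : ℝ) = Real.exp (s ^ 6)) :
    ∃ (p J : ℕ) (S : RingSystem L p J) (α : ℝ), 0 < J ∧ s ^ 4 * Real.exp (s ^ 2) ≤ p ∧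
      S.famProb Finset.univ ≤ α ∧ (∀ j : Fin J, S.famProb {0} * S.famProb {j.succ} ≤ α) ∧
      4 * p ^ 2 * ((6 * L + 1) * J * α) ≤ Real.exp (-3) := by
  obtain ⟨x, hxs⟩ : ∃ x, x = s ^ 2 := ⟨_, rfl⟩
  obtain ⟨y, hys⟩ : ∃ y, y = s ^ 3 := ⟨_, rfl⟩
  have hx : 40000 ≤ x := by rw [hxs]; nlinarith
  have hxy : 200 * x ≤ y := by rw [hxs, hys]; nlinarith [sq_nonneg s]
  have hy : y ^ 2 = x ^ 3 := by rw [hxs, hys]; ring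
  have hL' : (L : ℝ) = Real.exp (y ^ 2) := by rw [hL, hys]; congr 1; ring
  have ht : s ^ 4 * Real.exp (s ^ 2) = x ^ 2 * Real.exp x := by rw [hxs]; ring_nf
  rw [ht]
  have hy0 : 8000000 ≤ y := by linarith
  have h2e : (2 : ℝ) ≤ Real.exp 1 := by have := Real.add_one_le_exp (1 : ℝ); linarith
  set p := ⌈x ^ 2 * Real.exp x⌉₊ with hpdef
  set J := ⌊y⌋₊ with hJdef
  set M := ⌈Real.exp (y ^ 2 / 4)⌉₊ with hMdef
  have hpt : x ^ 2 * Real.exp x ≤ p := Nat.le_ceil _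
  have hp : (p : ℝ) ≤ Real.exp (2 * x) := by
    have h1 : (p : ℝ) < x ^ 2 * Real.exp x + 1 := Nat.ceil_lt_add_one (by positivity)
    have h2 := Real.pow_div_factorial_le_exp x (by linarith) 3
    have h3 : ((3 : ℕ).factorial : ℝ) = 6 := by norm_num [Nat.factorial]
    rw [h3] at h2
    have h4 : x ^ 2 + 1 ≤ x ^ 3 / 6 := by nlinarith
    have h5 : 1 ≤ Real.exp x := Real.one_le_exp (by linarith)
    have h6 : Real.exp (2 * x) = Real.exp x * Real.exp x := by rw [← Real.exp_add]; ring_nf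
    rw [h6]
    nlinarith
  have hp2 : 2 ≤ p := by
    have h1 : (2 : ℝ) ≤ x ^ 2 * Real.exp x := by
      have h5 : 1 ≤ Real.exp x := Real.one_le_exp (by linarith)
      nlinarith
    exact_mod_cast h1.trans hpt
  have hJ : (J : ℝ) ≤ y := Nat.floor_le (by linarith)
  have hJ' : y ≤ J + 1 := (Nat.lt_floor_add_one y).le
  have hJpos : 0 < J := Nat.floor_pos.2 (by linarith)
  have hM : Real.exp (y ^ 2 / 4) ≤ M := Nat.le_ceil _
  have hMe : 2 ≤ Real.exp (y ^ 2 / 4) := h2e.trans (Real.exp_le_exp.2 (by nlinarith))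
  have hM2 : 2 ≤ M := by exact_mod_cast hMe.trans hM
  have hM' : (M : ℝ) ≤ Real.exp 1 * Real.exp (y ^ 2 / 4) := by
    have h1 : (M : ℝ) < Real.exp (y ^ 2 / 4) + 1 := Nat.ceil_lt_add_one (by positivity)
    nlinarith
  have hD : ((2 ^ J * M : ℕ) : ℝ) ≤ Real.exp (1 + y + y ^ 2 / 4) := by
    push_cast
    calc (2 : ℝ) ^ J * M ≤ Real.exp 1 ^ J * (Real.exp 1 * Real.exp (y ^ 2 / 4)) := by gcongr
      _ = Real.exp (1 + J + y ^ 2 / 4) := by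
          rw [← Real.exp_nat_mul, ← Real.exp_add, ← Real.exp_add]; ring_nf
      _ ≤ _ := by gcongr
  have hLg : L < p * (L / p + 1) := Nat.lt_mul_div_succ L (by omega)
  have hLp : p < L := by
    have : (p : ℝ) < L := by
      rw [hL']
      exact hp.trans_lt (Real.exp_lt_exp.2 (by nlinarith))
    exact_mod_cast this
  have hgap : 2 * p * (2 ^ J * M) ≤ L / p + 1 := by
    have h1 : ((2 * p * (2 ^ J * M) * p : ℕ) : ℝ) ≤ L := by
      calc ((2 * p * (2 ^ J * M) * p : ℕ) : ℝ) = 2 * (p : ℝ) ^ 2 * ((2 ^ J * M : ℕ) : ℝ) := by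
            push_cast; ring
        _ ≤ Real.exp 1 * Real.exp (2 * x) ^ 2 * Real.exp (1 + y + y ^ 2 / 4) := by gcongr
        _ = Real.exp (4 * x + 2 + y + y ^ 2 / 4) := by
            rw [← Real.exp_nat_mul, ← Real.exp_add, ← Real.exp_add]; push_cast; ring_nf
        _ ≤ L := by
            rw [hL']
            exact Real.exp_le_exp.2 (by nlinarith)
    have h2 : 2 * p * (2 ^ J * M) * p ≤ L := by exact_mod_cast h1
    have h3 : 2 * p * (2 ^ J * M) * p < (L / p + 1) * p := by
      rw [mul_comm (L / p + 1)]; exact h2.trans_lt hLg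
    exact (Nat.lt_of_mul_lt_mul_right h3).le
  have hgap4 : 4 * (2 ^ J * M) ≤ L / p + 1 :=
    (Nat.mul_le_mul_right _ (by omega : 4 ≤ 2 * p)).trans hgap
  have hgL : p * (L / p + 1) < 2 * L := by
    have := Nat.mul_div_le L p
    rw [mul_add, mul_one]
    omega
  have hA : ∀ j : Fin J, 2 * (J + 1) * (RingSystem.dyadic hM2 hgap4 hgap hgL).const j.succ ≤
      Real.exp (-1) := fun j => by
    have h1 : y ^ 2 / 4 ≤ Real.log M := by
      rw [Real.le_log_iff_exp_le (by positivity)]; exact hM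
    have h0 : 0 < y ^ 2 / 4 := by positivity
    calc _ ≤ 2 * (2 * y) * (72 / (y ^ 2 / 4)) := by
          refine mul_le_mul (by linarith) ((RingSystem.const_dyadic_le _ _ _ _ j).trans
            (by gcongr)) (RingSystem.const_pos _ _).le (by positivity)
      _ = 1152 / y := by field_simp; ring
      _ ≤ 1 / 3 := by rw [div_le_div_iff₀ (by linarith) (by norm_num)]; linarith
      _ ≤ Real.exp (-1) := by
          rw [Real.exp_neg, one_div]
          exact inv_anti₀ (Real.exp_pos 1) Real.exp_one_lt_three.le
  set S := RingSystem.dyadic hM2 hgap4 hgap hgL with hS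
  have hg : (0 : ℝ) < S.gap := by exact_mod_cast S.gap_pos
  refine ⟨p, J, S, _, hJpos, hpt, ?_, fun j => ?_, S.bracket_le hx hxy hy hL' hJ hJ' hp
    (D := ((2 ^ J * M : ℕ) : ℝ)) le_rfl hD (by exact_mod_cast hLg.le) rfl⟩
  · refine (S.famProb_univ_le hA).trans ?_
    gcongr
    exact le_add_of_nonneg_right (by positivity)
  · rw [S.famProb_zero]
    gcongr
    exact (S.famProb_succ_le hA j).trans (le_add_of_nonneg_left (by positivity))

end RI

/-- **Bound on the strip-crossing probability** ((3.22)).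
For `L₀ ≥ c(κ)`, with `u₀ = κ (log L₀)² L₀^{-(d-2)}` and `Q` any vacant-set law at level
`u₀`: the probability that `{x : Y_x = 0}` contains a `*`-path in
`([0,2L₀] × [0,6L₀] × {0}^{d-2}) ∩ ℤ^d` from `{0} × [0,6L₀] × {0}^{d-2}` to
`{2L₀-1} × [0,6L₀] × {0}^{d-2}` is at most `exp{-c' (log L₀)^{2/3} exp((log L₀)^{1/3})}`. -/
theorem strip_crossing_bound (d : ℕ) (hd : 3 ≤ d) (κ : ℝ) (hκ : 0 < κ) :
    ∃ c c' : ℝ, 0 < c ∧ 0 < c' ∧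
      ∀ L0 : ℕ, c ≤ (L0 : ℝ) →
        ∀ (P : Zd d → Measure (ℕ → Zd d)), IsSRW d P →
          ∀ Q : Measure (Zd d → Bool),
            IsVacantLaw P (κ * (Real.log L0) ^ 2 * (L0 : ℝ) ^ (-((d : ℝ) - 2))) Q →
            (Q {Y | HasStarPath
                {x : Zd d | inPlane x ∧ coord x 0 = 0 ∧
                  0 ≤ coord x 1 ∧ coord x 1 ≤ (6 * L0 : ℤ)}
                {x : Zd d | inPlane x ∧ coord x 0 = (2 * L0 : ℤ) - 1 ∧
                  0 ≤ coord x 1 ∧ coord x 1 ≤ (6 * L0 : ℤ)}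
                {x : Zd d | inPlane x ∧ 0 ≤ coord x 0 ∧ coord x 0 ≤ (2 * L0 : ℤ) ∧
                  0 ≤ coord x 1 ∧ coord x 1 ≤ (6 * L0 : ℤ) ∧ Y x = false}}).toReal ≤
              Real.exp (-(c' * (Real.log L0) ^ ((2 : ℝ) / 3) *
                Real.exp ((Real.log L0) ^ ((1 : ℝ) / 3)))) := by
  set C : ℝ := κ * (29 * d) ^ d with hC
  have hC0 : 0 < C := by positivity
  set s₀ : ℝ := max 200 (120 * C) with hs₀
  refine ⟨Real.exp (s₀ ^ 6), 1, Real.exp_pos _, one_pos, fun L0 hL0 P hP Q hQ => ?_⟩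
  have hLpos : (0 : ℝ) < L0 := (Real.exp_pos _).trans_le hL0
  have hlog : s₀ ^ 6 ≤ Real.log L0 := (Real.le_log_iff_exp_le hLpos).2 hL0
  have hs₀0 : 200 ≤ s₀ := le_max_left _ _
  have hlog0 : 0 ≤ Real.log L0 := (by positivity : (0 : ℝ) ≤ s₀ ^ 6).trans hlog
  obtain ⟨s, hs⟩ : ∃ s, s = Real.log L0 ^ ((1 : ℝ) / 6) := ⟨_, rfl⟩
  have hpow : ∀ n : ℕ, Real.log L0 ^ ((n : ℝ) / 6) = s ^ n := fun n => by
    rw [hs, ← Real.rpow_natCast, ← Real.rpow_mul hlog0]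
    congr 1
    ring
  have hs0 : 0 ≤ s := hs ▸ Real.rpow_nonneg hlog0 _
  have h6 : Real.log L0 = s ^ 6 := by
    rw [← hpow 6]
    norm_num
  have h4 : Real.log L0 ^ ((2 : ℝ) / 3) = s ^ 4 := by
    rw [← hpow 4]
    norm_num
  have h2 : Real.log L0 ^ ((1 : ℝ) / 3) = s ^ 2 := by
    rw [← hpow 2]
    norm_num
  have hss : s₀ ≤ s := le_of_pow_le_pow_left₀ (by norm_num) hs0 (h6 ▸ hlog)
  have hs200 : 200 ≤ s := hs₀0.trans hss
  have hsC : 120 * C ≤ s := (le_max_right _ _).trans hss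
  obtain ⟨p, J, S, α, hJ, hp, h_univ, h_pair, hbr⟩ :=
    exists_ringSystem hs200 (by rw [← h6, Real.exp_log hLpos])
  have hα : 0 ≤ α := (S.famProb_nonneg _).trans h_univ
  have key := S.measure_crossing_le hJ hd hP h_univ h_pair (by positivity) hQ
  have hlam := level_mul_capa_le hd hP hκ.le (L := L0) (by exact_mod_cast hLpos)
  set lam := κ * (Real.log L0) ^ 2 * (L0 : ℝ) ^ (-((d : ℝ) - 2)) * capa P (fbox d (7 * L0))
  have hlamp : lam ≤ p := by
    refine (hlam.trans ?_).trans hp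
    have h5 := Real.pow_div_factorial_le_exp (s ^ 2) (by positivity) 5
    have hf : ((5 : ℕ).factorial : ℝ) = 120 := by norm_num [Nat.factorial]
    rw [hf] at h5
    calc κ * (29 * d) ^ d * (Real.log L0) ^ 2 = C * s ^ 12 := by rw [h6, hC]; ring
      _ ≤ s ^ 2 / 120 * s ^ 12 := by
          gcongr
          nlinarith
      _ = s ^ 4 * ((s ^ 2) ^ 5 / 120) := by ring
      _ ≤ _ := by gcongr
  refine key.trans ?_
  rw [h4, h2, one_mul]
  calc _ ≤ Real.exp (2 * p) * Real.exp (-3) ^ p := by gcongr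
    _ = Real.exp (-p) := by
        rw [← Real.exp_nat_mul, ← Real.exp_add]
        congr 1
        ring
    _ ≤ _ := Real.exp_le_exp.2 (neg_le_neg hp)
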